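/- arXiv:0811.2541 — 8 statements merged into one kernel-verified Lean document; each statement's English description precedes it below -/
import Mathlib

section
/- Let φ : M → N be a homomorphism of monoids such that N is locally finite and such that for all n₁, n₂ ∈ N the trace monoid tr_φ(n₁,n₂) is locally finite. Then M is locally finite. -/
/-- The submonoid `{m ∈ M ∣ n₁·φ(m) = n₁ and φ(m)·n₂ = n₂}` of `M`. -/
def traceSubmonoid {M N : Type*} [Monoid M] [Monoid N] (φ : M →* N) (n₁ n₂ : N) :
    Submonoid M where
  carrier := {m | n₁ * φ m = n₁ ∧ φ m * n₂ = n₂}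
  one_mem' := by simp
  mul_mem' := by
    rintro a b ⟨ha1, ha2⟩ ⟨hb1, hb2⟩
    refine ⟨?_, ?_⟩
    · rw [map_mul, ← mul_assoc, ha1, hb1]
    · rw [map_mul, mul_assoc, hb2, ha2]

/-- The congruence `m ≡ m' iff m₁ m m₂ = m₁ m' m₂ for all m₁ ∈ φ⁻¹(n₁), m₂ ∈ φ⁻¹(n₂)`
on `traceSubmonoid φ n₁ n₂`. -/
def traceCon {M N : Type*} [Monoid M] [Monoid N] (φ : M →* N) (n₁ n₂ : N) :
    Con (traceSubmonoid φ n₁ n₂) where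
  r a b := ∀ m₁ m₂ : M, φ m₁ = n₁ → φ m₂ = n₂ → m₁ * ↑a * m₂ = m₁ * ↑b * m₂
  iseqv :=
    ⟨fun _ _ _ _ _ => rfl, fun h m₁ m₂ h₁ h₂ => (h m₁ m₂ h₁ h₂).symm,
      fun h h' m₁ m₂ h₁ h₂ => (h m₁ m₂ h₁ h₂).trans (h' m₁ m₂ h₁ h₂)⟩
  mul' := by
    rintro a b c d hab hcd m₁ m₂ h₁ h₂
    have hc1 : φ (m₁ * ↑a) = n₁ := by rw [map_mul, h₁]; exact a.2.1
    have hd2 : φ (↑d * m₂) = n₂ := by rw [map_mul, h₂]; exact d.2.2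
    calc
      m₁ * ↑(a * c) * m₂ = m₁ * ↑a * ↑c * m₂ := by
        simp only [Submonoid.coe_mul, mul_assoc]
      _ = m₁ * ↑a * ↑d * m₂ := hcd (m₁ * ↑a) m₂ hc1 h₂
      _ = m₁ * ↑b * (↑d * m₂) := by
        rw [mul_assoc (m₁ * ↑a)]
        exact hab m₁ (↑d * m₂) h₁ hd2
      _ = m₁ * ↑(b * d) * m₂ := by
        simp only [Submonoid.coe_mul, mul_assoc]

/-- The trace of `φ` at `(n₁, n₂)`: the quotient of `traceSubmonoid φ n₁ n₂`
by the congruence `traceCon φ n₁ n₂`. -/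
def traceMonoid {M N : Type*} [Monoid M] [Monoid N] (φ : M →* N) (n₁ n₂ : N) : Type _ :=
  (traceCon φ n₁ n₂).Quotient

noncomputable instance {M N : Type*} [Monoid M] [Monoid N] (φ : M →* N) (n₁ n₂ : N) :
    Monoid (traceMonoid φ n₁ n₂) :=
  inferInstanceAs (Monoid (traceCon φ n₁ n₂).Quotient)

/-- A monoid is locally finite if all its finitely generated submonoids are finite. -/
def Monoid.LocallyFinite (M : Type*) [Monoid M] : Prop :=
  ∀ S : Submonoid M, S.FG → (S : Set M).Finite

/-- **Brown's lemma**, finite form: for every `C`, a sufficiently long interval coloured by a finite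
set contains, for some colour `c` and some `d`, a sequence of `C c d` steps between points of
colour `c`, each of size at most `d`. -/
theorem exists_monochromatic_bounded_gaps {α : Type*} (C : α → ℕ → ℕ) (T : Finset α) :
    ∃ K : ℕ, ∀ (f : ℕ → α) (a : ℕ), (∀ i, a ≤ i → i < a + K → f i ∈ T) →
      ∃ c ∈ T, ∃ (d : ℕ) (g : ℕ → ℕ),
        (∀ j < C c d, g j < g (j + 1) ∧ g (j + 1) ≤ g j + d) ∧
        ∀ j ≤ C c d, g j < a + K ∧ f (g j) = c := by
  classical
  induction T using Finset.induction_on with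
  | empty => exact ⟨1, fun f a h => by simpa using h a le_rfl (by omega)⟩
  | insert x T _ ih =>
    obtain ⟨K, hK⟩ := ih
    set L := (C x K + 1) * (K + 1) with hL
    refine ⟨L, fun f a hf => ?_⟩
    by_cases hex : ∃ b, a ≤ b ∧ b + K ≤ a + L ∧ ∀ i, b ≤ i → i < b + K → f i ≠ x
    · obtain ⟨b, hab, hbL, hb⟩ := hex
      obtain ⟨c, hc, d, g, hg, hgc⟩ := hK f b fun i h₁ h₂ =>
        Finset.mem_of_mem_insert_of_ne (hf i (by omega) (by omega)) (hb i h₁ h₂)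
      exact ⟨c, Finset.mem_insert_of_mem hc, d, g, hg,
        fun j hj => ⟨(hgc j hj).1.trans_le hbL, (hgc j hj).2⟩⟩
    · have hnext : ∀ b, ∃ i, a ≤ b → b + K ≤ a + L → b ≤ i ∧ i < b + K ∧ f i = x := by
        intro b
        by_contra! h
        refine hex ⟨b, (h 0).1, (h 0).2.1, fun i h₁ h₂ => (h i).2.2 h₁ h₂⟩
      choose nxt hnxt using hnext
      let g : ℕ → ℕ := fun j => Nat.rec (nxt a) (fun _ i => nxt (i + 1)) j
      have hstep (j : ℕ) (hj : j ≤ C x K) : (j + 1) * (K + 1) ≤ L :=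
        Nat.mul_le_mul_right _ (by omega)
      have hg : ∀ j ≤ C x K, a ≤ g j ∧ g j + 1 ≤ a + (j + 1) * (K + 1) ∧ f (g j) = x := by
        intro j
        induction j with
        | zero =>
          intro hj
          have h₀ := hstep 0 hj
          obtain ⟨h₁, h₂, h₃⟩ := hnxt a le_rfl (by omega)
          exact ⟨h₁, by change nxt a + 1 ≤ _; omega, h₃⟩
        | succ j ihj =>
          intro hj
          obtain ⟨h₁, h₂, -⟩ := ihj (by omega)
          have h₀ := hstep (j + 1) hj
          have h₀' : (j + 1 + 1) * (K + 1) = (j + 1) * (K + 1) + (K + 1) := by ring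
          obtain ⟨h₄, h₅, h₆⟩ := hnxt (g j + 1) (by omega) (by omega)
          exact ⟨by change a ≤ nxt (g j + 1); omega,
            by change nxt (g j + 1) + 1 ≤ _; omega, h₆⟩
      refine ⟨x, Finset.mem_insert_self x T, K, g, fun j hj => ?_, fun j hj => ?_⟩
      · obtain ⟨h₁, h₂, -⟩ := hg j hj.le
        have h₀ := hstep (j + 1) hj
        have h₀' : (j + 1 + 1) * (K + 1) = (j + 1) * (K + 1) + (K + 1) := by ring
        obtain ⟨h₄, h₅, -⟩ := hnxt (g j + 1) (by omega) (by omega)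
        exact ⟨by change _ < nxt (g j + 1); omega, by change nxt (g j + 1) ≤ _; omega⟩
      · have h₀ := hstep j hj
        obtain ⟨-, h₂, h₃⟩ := hg j hj
        exact ⟨by omega, h₃⟩

theorem Set.Finite.lists_length_le {α : Type*} {A : Set α} (hA : A.Finite) (d : ℕ) :
    {u : List α | (∀ x ∈ u, x ∈ A) ∧ u.length ≤ d}.Finite := by
  have := hA.to_subtype
  refine ((List.finite_length_le A d).image (List.map Subtype.val)).subset ?_
  rintro u ⟨hu, hd⟩
  lift u to List A using hu
  exact ⟨u, by simpa using hd, rfl⟩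

/-- The submonoid of `traceSubmonoid φ n₁ n₂` generated by the products of words over `A` of length
at most `d`. -/
def shortWordClosure {M N : Type*} [Monoid M] [Monoid N] (φ : M →* N) (n₁ n₂ : N)
    (A : Set M) (d : ℕ) : Submonoid (traceSubmonoid φ n₁ n₂) :=
  Submonoid.closure {t | ∃ u : List M, (∀ x ∈ u, x ∈ A) ∧ u.length ≤ d ∧ u.prod = t}

theorem exists_word_of_mem_shortWordClosure {M N : Type*} [Monoid M] [Monoid N] {φ : M →* N}
    {n₁ n₂ : N} {A : Set M} {d : ℕ} {t : traceSubmonoid φ n₁ n₂}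
    (ht : t ∈ shortWordClosure φ n₁ n₂ A d) :
    ∃ v : List M, (∀ x ∈ v, x ∈ A) ∧ v.prod = t := by
  induction ht using Submonoid.closure_induction with
  | mem t ht =>
    obtain ⟨u, hu, -, hut⟩ := ht
    exact ⟨u, hu, hut⟩
  | one => exact ⟨[], by simp, by simp⟩
  | mul s t _ _ hs ht =>
    obtain ⟨u, hu, hus⟩ := hs
    obtain ⟨v, hv, hvt⟩ := ht
    refine ⟨u ++ v, fun x hx => ?_, by simp [hus, hvt]⟩
    exact (List.mem_append.1 hx).elim (hu x) (hv x)

theorem exists_length_bound_of_trace {M N : Type*} [Monoid M] [Monoid N] (φ : M →* N)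
    {n₁ n₂ : N} (htr : Monoid.LocallyFinite (traceMonoid φ n₁ n₂)) {A : Set M} (hA : A.Finite)
    (d : ℕ) :
    ∃ B : ℕ, ∀ t ∈ shortWordClosure φ n₁ n₂ A d, ∃ v : List M,
      (∀ x ∈ v, x ∈ A) ∧ v.length ≤ B ∧
        ∀ m₁ m₂ : M, φ m₁ = n₁ → φ m₂ = n₂ → m₁ * t * m₂ = m₁ * v.prod * m₂ := by
  let π : traceSubmonoid φ n₁ n₂ →* traceMonoid φ n₁ n₂ := (traceCon φ n₁ n₂).mk'
  have hfg : (shortWordClosure φ n₁ n₂ A d).FG := by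
    refine Submonoid.fg_iff _ |>.2 ⟨_, rfl, ?_⟩
    refine Set.Finite.of_finite_image (f := Subtype.val) ?_ Subtype.val_injective.injOn
    refine ((hA.lists_length_le d).image List.prod).subset ?_
    rintro _ ⟨t, ⟨u, hu, hd, hut⟩, rfl⟩
    exact ⟨u, ⟨hu, hd⟩, hut⟩
  have hfin : (π '' shortWordClosure φ n₁ n₂ A d).Finite := by
    simpa using htr _ (hfg.map π)
  have hword : ∀ q : traceMonoid φ n₁ n₂, ∃ v : List M, q ∈ π '' shortWordClosure φ n₁ n₂ A d →
      (∀ x ∈ v, x ∈ A) ∧ ∃ t : traceSubmonoid φ n₁ n₂, v.prod = t ∧ π t = q := by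
    intro q
    by_cases hq : q ∈ π '' shortWordClosure φ n₁ n₂ A d
    · obtain ⟨t, ht, rfl⟩ := hq
      obtain ⟨v, hv, hvt⟩ := exists_word_of_mem_shortWordClosure ht
      exact ⟨v, fun _ => ⟨hv, t, hvt, rfl⟩⟩
    · exact ⟨[], fun h => absurd h hq⟩
  choose word hword using hword
  obtain ⟨B, hB⟩ := (hfin.image fun q => (word q).length).bddAbove
  refine ⟨B, fun t ht => ?_⟩
  have hq : π t ∈ π '' shortWordClosure φ n₁ n₂ A d := ⟨t, ht, rfl⟩
  obtain ⟨hv, s, hvs, hst⟩ := hword (π t) hq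
  refine ⟨word (π t), hv, hB ⟨π t, hq, rfl⟩, fun m₁ m₂ h₁ h₂ => ?_⟩
  rw [hvs]
  exact (traceCon φ n₁ n₂).eq.1 hst.symm m₁ m₂ h₁ h₂

/-- The product of the factor of a word between two positions with equal values of prefix and
equal values of suffix, joined by a chain of such positions with gaps at most `d`. -/
theorem exists_mem_shortWordClosure_of_bounded_gaps {M N : Type*} [Monoid M] [Monoid N]
    (φ : M →* N) {n₁ n₂ : N} {A : Set M} {d r : ℕ} {w : List M} (hw : ∀ x ∈ w, x ∈ A)
    {g : ℕ → ℕ} (hg : ∀ j < r, g j < g (j + 1) ∧ g (j + 1) ≤ g j + d)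
    (hn : ∀ j ≤ r, φ (w.take (g j)).prod = n₁ ∧ φ (w.drop (g j)).prod = n₂) :
    ∃ t ∈ shortWordClosure φ n₁ n₂ A d,
      (w.take (g r)).prod = (w.take (g 0)).prod * t ∧ g 0 + r ≤ g r := by
  induction r with
  | zero => exact ⟨1, one_mem _, by simp, le_rfl⟩
  | succ r ih =>
    obtain ⟨t, ht, htr, hr⟩ := ih (fun j hj => hg j (by omega)) fun j hj => hn j (by omega)
    obtain ⟨hlt, hle⟩ := hg r (by omega)
    obtain ⟨k, hk⟩ := Nat.exists_eq_add_of_lt hlt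
    set u := (w.drop (g r)).take (k + 1) with hu
    have htake : w.take (g (r + 1)) = w.take (g r) ++ u := by
      rw [hk, add_assoc, List.take_add]
    have hdrop : w.drop (g r) = u ++ w.drop (g (r + 1)) := by
      rw [hk, add_assoc, ← List.drop_drop, List.take_append_drop]
    have hmem : u.prod ∈ traceSubmonoid φ n₁ n₂ := by
      refine ⟨?_, ?_⟩
      · rw [← (hn r (by omega)).1, ← map_mul, ← List.prod_append, ← htake,
          (hn (r + 1) le_rfl).1, (hn r (by omega)).1]
      · rw [← (hn (r + 1) le_rfl).2, ← map_mul, ← List.prod_append, ← hdrop,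
          (hn (r + 1) le_rfl).2, (hn r (by omega)).2]
    refine ⟨t * ⟨u.prod, hmem⟩, mul_mem ht (Submonoid.subset_closure ⟨u, fun x hx => ?_, ?_, rfl⟩),
      ?_, by omega⟩
    · exact hw x (List.mem_of_mem_drop (List.mem_of_mem_take hx))
    · exact (List.length_take_le _ _).trans (by omega)
    · rw [htake, List.prod_append, htr, mul_assoc, Submonoid.coe_mul]

/-- **Theorem.** If `φ : M →* N` is a monoid homomorphism such that `N` is locally finite
and every trace monoid `tr_φ(n₁,n₂)` is locally finite, then `M` is locally finite. -/
theorem locallyFinite_of_traces_locallyFinite {M N : Type*} [Monoid M] [Monoid N]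
    (φ : M →* N) (hN : Monoid.LocallyFinite N)
    (htr : ∀ n₁ n₂ : N, Monoid.LocallyFinite (traceMonoid φ n₁ n₂)) :
    Monoid.LocallyFinite M := by
  intro S hS
  have hT : ((S.map φ : Set N) ×ˢ (S.map φ : Set N)).Finite :=
    (hN _ (hS.map φ)).prod (hN _ (hS.map φ))
  obtain ⟨A, rfl, hA⟩ := (Submonoid.fg_iff S).1 hS
  choose B hB using fun (c : N × N) (d : ℕ) =>
    exists_length_bound_of_trace φ (htr c.1 c.2) hA d
  obtain ⟨K, hK⟩ := exists_monochromatic_bounded_gaps (fun c d => B c d + 1) hT.toFinset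
  refine ((hA.lists_length_le K).image List.prod).subset fun m hm => ?_
  have hex : ∃ n, ∃ w : List M, (∀ x ∈ w, x ∈ A) ∧ w.prod = m ∧ w.length = n := by
    obtain ⟨w, hw, hwm⟩ := Submonoid.exists_list_of_mem_closure hm
    exact ⟨_, w, hw, hwm, rfl⟩
  classical
  obtain ⟨w, hw, hwm, hwn⟩ := Nat.find_spec hex
  refine ⟨w, ⟨hw, ?_⟩, hwm⟩
  by_contra! hlen
  have hcolour : ∀ i, (φ (w.take i).prod, φ (w.drop i).prod) ∈ hT.toFinset := by
    intro i
    rw [Set.Finite.mem_toFinset]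
    exact ⟨Submonoid.mem_map_of_mem φ (Submonoid.list_prod_mem _ fun x hx =>
        Submonoid.subset_closure (hw x (List.mem_of_mem_take hx))),
      Submonoid.mem_map_of_mem φ (Submonoid.list_prod_mem _ fun x hx =>
        Submonoid.subset_closure (hw x (List.mem_of_mem_drop hx)))⟩
  obtain ⟨c, -, d, g, hg, hgc⟩ := hK _ 0 fun i _ _ => hcolour i
  have hn : ∀ j ≤ B c d + 1, φ (w.take (g j)).prod = c.1 ∧ φ (w.drop (g j)).prod = c.2 :=
    fun j hj => Prod.ext_iff.1 (hgc j hj).2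
  obtain ⟨t, ht, htake, hlong⟩ := exists_mem_shortWordClosure_of_bounded_gaps φ hw hg hn
  obtain ⟨v, hv, hvB, hvt⟩ := hB c d t ht
  have hend := (hgc _ le_rfl).1
  refine Nat.find_min hex (m := (w.take (g 0) ++ v ++ w.drop (g (B c d + 1))).length) ?_
    ⟨_, fun x hx => ?_, ?_, rfl⟩
  · rw [← hwn]
    simp only [List.length_append, List.length_take, List.length_drop]
    omega
  · rcases List.mem_append.1 hx with hx | hx
    · exact (List.mem_append.1 hx).elim (fun h => hw x (List.mem_of_mem_take h)) (hv x)
    · exact hw x (List.mem_of_mem_drop hx)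
  · rw [List.prod_append, List.prod_append, ← hvt _ _ (hn 0 (by omega)).1 (hn _ le_rfl).2,
      ← htake, ← List.prod_append, List.take_append_drop, hwm]
end

section
/- Let C be a category all of whose endomorphism monoids C(c,c) are locally finite. Then C is locally finite; concretely, for every finite quiver Γ and every functor φ from the free category on Γ to C, the set of morphisms of C in the image of φ is finite. -/
open CategoryTheory

/-- The composites of one or more generating morphisms between the objects `F v`, all of whose
intermediate vertices lie in `V`. -/
inductive CompositeThrough {C : Type*} [Category C] {ι : Type*} {F : ι → C}
    (E : ∀ a b, Set (F a ⟶ F b)) (V : Set ι) : ∀ a b, (F a ⟶ F b) → Prop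
  | of {a b : ι} {f : F a ⟶ F b} (hf : f ∈ E a b) : CompositeThrough E V a b f
  | comp {a v b : ι} {f : F a ⟶ F v} {g : F v ⟶ F b} (hv : v ∈ V)
      (hf : CompositeThrough E V a v f) (hg : CompositeThrough E V v b g) :
      CompositeThrough E V a b (f ≫ g)

namespace CompositeThrough

variable {C : Type*} [Category C] {ι : Type*} {F : ι → C} {E : ∀ a b, Set (F a ⟶ F b)}

/-- The submonoid of `End (F v)` generated by the loops at `v` through `V`. -/
def loops (E : ∀ a b, Set (F a ⟶ F b)) (V : Set ι) (v : ι) : Submonoid (End (F v)) :=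
  Submonoid.closure {f : End (F v) | CompositeThrough E V v v f}

theorem comp_mem_loops {V : Set ι} {v : ι} {f g : F v ⟶ F v}
    (hf : f ∈ loops E V v) (hg : g ∈ loops E V v) : f ≫ g ∈ loops E V v :=
  (loops E V v).mul_mem hg hf

theorem mem_loops {V : Set ι} {v : ι} {f : F v ⟶ F v} (hf : CompositeThrough E V v v f) :
    f ∈ loops E V v :=
  Submonoid.subset_closure hf

theorem of_insert {V : Set ι} {v a b : ι} {f : F a ⟶ F b}
    (hf : CompositeThrough E (insert v V) a b f) :
    CompositeThrough E V a b f ∨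
      ∃ p m q, CompositeThrough E V a v p ∧ m ∈ loops E V v ∧ CompositeThrough E V v b q ∧
        p ≫ m ≫ q = f := by
  induction hf with
  | of hf => exact .inl (.of hf)
  | @comp a w b f g hw _ _ ihf ihg =>
    rcases hw with rfl | hw
    · right
      rcases ihf with hf | ⟨p, m, q, hp, hm, hq, rfl⟩ <;>
        rcases ihg with hg | ⟨p', m', q', hp', hm', hq', rfl⟩
      · exact ⟨f, 𝟙 _, g, hf, (loops E V w).one_mem, hg, by simp⟩
      · exact ⟨f, p' ≫ m', q', hf, comp_mem_loops (mem_loops hp') hm', hq', by simp⟩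
      · exact ⟨p, m ≫ q, g, hp, comp_mem_loops hm (mem_loops hq), hg, by simp⟩
      · exact ⟨p, m ≫ q ≫ p' ≫ m', q', hp, comp_mem_loops hm (comp_mem_loops (mem_loops hq)
          (comp_mem_loops (mem_loops hp') hm')), hq', by simp⟩
    · rcases ihf with hf | ⟨p, m, q, hp, hm, hq, rfl⟩ <;>
        rcases ihg with hg | ⟨p', m', q', hp', hm', hq', rfl⟩
      · exact .inl (.comp hw hf hg)
      · exact .inr ⟨f ≫ p', m', q', .comp hw hf hp', hm', hq', by simp⟩
      · exact .inr ⟨p, m, q ≫ g, hp, hm, .comp hw hq hg, by simp⟩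
      · exact .inr ⟨p, m ≫ (q ≫ p') ≫ m', q', hp, comp_mem_loops hm
          (comp_mem_loops (mem_loops (.comp hw hq hp')) hm'), hq', by simp⟩

theorem finite (hEnd : ∀ c : C, Monoid.LocallyFinite (End c)) (hE : ∀ a b, (E a b).Finite)
    {V : Set ι} (hV : V.Finite) (a b : ι) : {f | CompositeThrough E V a b f}.Finite := by
  induction V, hV using Set.Finite.induction_on generalizing a b with
  | empty =>
    refine (hE a b).subset fun f hf => ?_
    cases hf with
    | of hf => exact hf
    | comp hv => exact hv.elim
  | @insert v V _ _ ih =>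
    have hloops : (loops E V v : Set (End (F v))).Finite :=
      hEnd _ _ ((Submonoid.fg_iff _).2 ⟨_, rfl, ih v v⟩)
    refine ((ih a b).union (((ih a v).prod (hloops.prod (ih v b))).image
      fun x => x.1 ≫ x.2.1 ≫ x.2.2)).subset fun f hf => ?_
    rcases of_insert hf with hf | ⟨p, m, q, hp, hm, hq, rfl⟩
    · exact .inl hf
    · exact .inr ⟨(p, m, q), ⟨hp, hm, hq⟩, rfl⟩

end CompositeThrough

theorem CategoryTheory.Paths.map_eq_id_or_compositeThrough {C : Type*} [Category C] {Γ : Type*}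
    [Quiver Γ] (φ : Paths Γ ⥤ C) {X Y : Γ} (g : Quiver.Path X Y) :
    (⟨Y, φ.map (X := X) (Y := Y) g⟩ : Σ Z : Γ, φ.obj X ⟶ φ.obj Z) = ⟨X, 𝟙 (φ.obj X)⟩ ∨
      CompositeThrough (F := φ.obj)
        (fun a b : Γ => Set.range fun e : a ⟶ b => φ.map ((Paths.of Γ).map e))
        Set.univ X Y (φ.map (X := X) (Y := Y) g) := by
  induction g with
  | nil =>
    left
    exact congrArg (Sigma.mk X) (φ.map_id X)
  | @cons Y Z p e ih =>
    right
    have key : φ.map (X := X) (Y := Z) (p.cons e) =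
        φ.map (X := X) (Y := Y) p ≫ φ.map ((Paths.of Γ).map e) :=
      φ.map_comp (X := X) (Y := Y) (Z := Z) p ((Paths.of Γ).map e)
    rw [key]
    rcases ih with h | h
    · obtain ⟨rfl, h⟩ := Sigma.mk.inj_iff.1 h
      rw [eq_of_heq h, Category.id_comp]
      exact .of ⟨e, rfl⟩
    · exact .comp trivial h (.of ⟨e, rfl⟩)

/-- **Lemma (Le Saëc, Pin, Weil).** If all endomorphism monoids of a category `C` are
locally finite, then `C` is locally finite:  for every finite quiver `Γ` (finitely many
vertices and finitely many edges between any two vertices) and every functor `φ` from the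
free (path) category on `Γ` to `C`, the set of morphisms of `C` in the image of `φ` is
finite. -/
theorem category_locallyFinite_of_end_locallyFinite {C : Type*} [Category C]
    (hEnd : ∀ c : C, Monoid.LocallyFinite (CategoryTheory.End c))
    (Γ : Type*) [Quiver Γ] [Fintype Γ] [∀ a b : Γ, Fintype (a ⟶ b)]
    (φ : Paths Γ ⥤ C) :
    {f : Σ (c c' : C), c ⟶ c' |
        ∃ (X Y : Paths Γ) (g : X ⟶ Y), f = ⟨φ.obj X, φ.obj Y, φ.map g⟩}.Finite := by
  let E : ∀ a b : Γ, Set (φ.obj a ⟶ φ.obj b) :=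
    fun a b => Set.range fun e : a ⟶ b => φ.map ((Paths.of Γ).map e)
  have hfin (X Y : Γ) : {f | CompositeThrough (F := φ.obj) E Set.univ X Y f}.Finite :=
    CompositeThrough.finite hEnd (fun _ _ => Set.finite_range _) Set.finite_univ X Y
  refine ((Set.finite_range fun X : Γ =>
    (⟨φ.obj X, φ.obj X, 𝟙 _⟩ : Σ (c c' : C), c ⟶ c')).union
    (Set.finite_iUnion fun X : Γ => Set.finite_iUnion fun Y : Γ => (hfin X Y).image
      fun f => (⟨φ.obj X, φ.obj Y, f⟩ : Σ (c c' : C), c ⟶ c'))).subset ?_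
  rintro _ ⟨X, Y, g, rfl⟩
  rcases Paths.map_eq_id_or_compositeThrough φ g with h | h
  · obtain ⟨rfl, h⟩ := Sigma.mk.inj_iff.1 h
    exact .inl ⟨Y, by rw [eq_of_heq h]⟩
  · exact .inr (Set.mem_iUnion.2 ⟨X, Set.mem_iUnion.2 ⟨Y, _, h, rfl⟩⟩)
end

section
/- Let φ : M → N be a homomorphism of monoids with M finitely generated and N finite. Then the kernel category K_φ is finitely generated. More precisely, if X is a finite generating set for M, then every arrow of K_φ is a composite of arrows of the form [n₁, x, n₂] with x ∈ X and n₁, n₂ ∈ N. -/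
open CategoryTheory

variable {M N : Type*} [Monoid M] [Monoid N]

/-- The kernel category `K_φ` of a monoid homomorphism `φ : M →* N`:  objects are pairs
`(n₁, n₂) ∈ N × N`. -/
structure KernelCategory {M N : Type*} [Monoid M] [Monoid N] (φ : M →* N) where
  fst : N
  snd : N

/-- The relation identifying two triples `(n₁, m, n₂)` and `(n₁, m', n₂)` (with the same
endpoints):  `m₁ m m₂ = m₁ m' m₂` for all `m₁ ∈ φ⁻¹(n₁)`, `m₂ ∈ φ⁻¹(n₂)`. -/
def kernelRel (φ : M →* N) (p q : KernelCategory φ)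
    (m m' : {m : M // p.fst * φ m = q.fst ∧ φ m * q.snd = p.snd}) : Prop :=
  ∀ m₁ m₂ : M, φ m₁ = p.fst → φ m₂ = q.snd → m₁ * ↑m * m₂ = m₁ * ↑m' * m₂

instance kernelCategoryStruct (φ : M →* N) : CategoryStruct (KernelCategory φ) where
  Hom p q := Quot (kernelRel φ p q)
  id p := Quot.mk _ ⟨1, by simp, by simp⟩
  comp {p q r} f g :=
    Quot.lift₂
      (fun m m' => (Quot.mk (kernelRel φ p r)
        ⟨↑m * ↑m', by rw [map_mul, ← mul_assoc, m.2.1, m'.2.1],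
          by rw [map_mul, mul_assoc, m'.2.2, m.2.2]⟩))
      (by
        intro m m' m'' h
        apply Quot.sound
        intro m₁ m₂ h₁ h₂
        have h₁' : φ (m₁ * ↑m) = q.fst := by rw [map_mul, h₁, m.2.1]
        calc m₁ * (↑m * ↑m') * m₂ = (m₁ * ↑m) * ↑m' * m₂ := by
              simp only [mul_assoc]
          _ = (m₁ * ↑m) * ↑m'' * m₂ := h (m₁ * ↑m) m₂ h₁' h₂
          _ = m₁ * (↑m * ↑m'') * m₂ := by simp only [mul_assoc]
      )
      (by
        intro m m'' m' h
        apply Quot.sound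
        intro m₁ m₂ h₁ h₂
        have h₂' : φ (↑m' * m₂) = q.snd := by rw [map_mul, h₂, m'.2.2]
        calc m₁ * (↑m * ↑m') * m₂ = m₁ * ↑m * (↑m' * m₂) := by
              simp only [mul_assoc]
          _ = m₁ * ↑m'' * (↑m' * m₂) := h m₁ (↑m' * m₂) h₁ h₂'
          _ = m₁ * (↑m'' * ↑m') * m₂ := by simp only [mul_assoc]
      )
      f g

instance kernelCategory (φ : M →* N) : Category (KernelCategory φ) where
  id_comp {p q} f := by
    refine Quot.inductionOn f fun m => ?_
    exact congrArg (Quot.mk _) (Subtype.ext (one_mul _))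
  comp_id {p q} f := by
    refine Quot.inductionOn f fun m => ?_
    exact congrArg (Quot.mk _) (Subtype.ext (mul_one _))
  assoc {p q r s} f g h := by
    refine Quot.inductionOn f fun a => ?_
    refine Quot.inductionOn g fun b => ?_
    refine Quot.inductionOn h fun c => ?_
    exact congrArg (Quot.mk _) (Subtype.ext (mul_assoc _ _ _))

/-- The arrow `[n₁, m, n₂] : (n₁, φ(m)·n₂) → (n₁·φ(m), n₂)` of the kernel category. -/
def kernelArrow (φ : M →* N) (n₁ : N) (m : M) (n₂ : N) :
    (⟨n₁, φ m * n₂⟩ : KernelCategory φ) ⟶ (⟨n₁ * φ m, n₂⟩ : KernelCategory φ) :=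
  Quot.mk _ ⟨m, rfl, rfl⟩

/-- `IsComposite S f` says that the arrow `f` is a composite of identities and arrows
belonging to the family `S`. -/
inductive IsComposite {C : Type*} [Category C] (S : ∀ a b : C, Set (a ⟶ b)) :
    ∀ {a b : C}, (a ⟶ b) → Prop
  | id (a : C) : IsComposite S (𝟙 a)
  | of {a b : C} (f : a ⟶ b) (hf : f ∈ S a b) : IsComposite S f
  | comp {a b c : C} {f : a ⟶ b} {g : b ⟶ c} :
      IsComposite S f → IsComposite S g → IsComposite S (f ≫ g)

/-- An arrow of `K_φ` represented by an element of the submonoid generated by `X` is a composite of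
arrows represented by elements of `X`. -/
theorem isComposite_mk_of_mem_closure {M N : Type*} [Monoid M] [Monoid N] (φ : M →* N)
    (X : Set M) {m : M} (hm : m ∈ Submonoid.closure X) :
    ∀ (p q : KernelCategory φ) (h : p.fst * φ m = q.fst ∧ φ m * q.snd = p.snd),
      IsComposite
        (fun a b => {f : a ⟶ b | ∃ x ∈ X, ∃ h, f = Quot.mk (kernelRel φ a b) ⟨x, h⟩})
        (show p ⟶ q from Quot.mk (kernelRel φ p q) ⟨m, h⟩) := by
  induction hm using Submonoid.closure_induction with
  | mem x hx => exact fun p q h => .of _ ⟨x, hx, h, rfl⟩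
  | one =>
    rintro ⟨p₁, p₂⟩ ⟨q₁, q₂⟩ ⟨h₁, h₂⟩
    obtain rfl : p₁ = q₁ := by simpa using h₁
    obtain rfl : q₂ = p₂ := by simpa using h₂
    exact .id _
  | mul x y _ _ ihx ihy =>
    intro p q h
    let r : KernelCategory φ := ⟨p.fst * φ x, φ y * q.snd⟩
    exact (ihx p r ⟨rfl, by simpa [r, mul_assoc] using h.2⟩).comp
      (ihy r q ⟨by simpa [r, mul_assoc] using h.1, rfl⟩)

instance {M N : Type*} [Monoid M] [Monoid N] [Finite N] (φ : M →* N) :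
    Finite (KernelCategory φ) :=
  Finite.of_injective (fun p : KernelCategory φ => (p.fst, p.snd)) fun p q h => by
    cases p; cases q; simpa using h

/-- Over a finite monoid, the arrows of `K_φ` represented by elements of a finite set form a
finite set. -/
theorem finite_setOf_arrow_mk_mem {M N : Type*} [Monoid M] [Monoid N] [Finite N] (φ : M →* N)
    {X : Set M} (hX : X.Finite) :
    {s : Σ (a b : KernelCategory φ), a ⟶ b |
      ∃ x ∈ X, ∃ h, s.2.2 = Quot.mk (kernelRel φ s.1 s.2.1) ⟨x, h⟩}.Finite := by
  have : Finite X := hX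
  refine (Set.finite_range fun t : Σ (a b : KernelCategory φ),
    {x : X // a.fst * φ x = b.fst ∧ φ x * b.snd = a.snd} =>
      (⟨t.1, t.2.1, Quot.mk (kernelRel φ t.1 t.2.1) ⟨t.2.2.1, t.2.2.2⟩⟩ :
        Σ (a b : KernelCategory φ), a ⟶ b)).subset ?_
  rintro ⟨a, b, f⟩ ⟨x, hx, h, hf⟩
  exact ⟨⟨a, b, ⟨⟨x, hx⟩, h⟩⟩, by dsimp only at hf ⊢; rw [hf]⟩

/-- **Proposition.** If `φ : M →* N` is a homomorphism of monoids with `M` finitely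
generated (by a finite set `X`) and `N` finite, then the kernel category `K_φ` is finitely
generated; more precisely every arrow of `K_φ` is a composite of arrows of the form
`[n₁, x, n₂]` with `x ∈ X` (and `n₁, n₂ ∈ N`). -/
theorem kernelCategory_finitelyGenerated {M N : Type*} [Monoid M] [Monoid N] [Finite N]
    (φ : M →* N) (X : Set M) (hXfin : X.Finite) (hXgen : Submonoid.closure X = ⊤) :
    (∀ (p q : KernelCategory φ) (f : p ⟶ q),
        IsComposite
          (fun a b => {f : a ⟶ b | ∃ x ∈ X, ∃ h, f = Quot.mk (kernelRel φ a b) ⟨x, h⟩}) f) ∧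
      ∃ T : Set (Σ (a b : KernelCategory φ), a ⟶ b), T.Finite ∧
        ∀ (p q : KernelCategory φ) (f : p ⟶ q),
          IsComposite
            (fun a b =>
              {f : a ⟶ b | (⟨a, b, f⟩ : Σ (a b : KernelCategory φ), a ⟶ b) ∈ T}) f := by
  have key : ∀ (p q : KernelCategory φ) (f : p ⟶ q),
      IsComposite
        (fun a b => {f : a ⟶ b | ∃ x ∈ X, ∃ h, f = Quot.mk (kernelRel φ a b) ⟨x, h⟩}) f := by
    intro p q f
    obtain ⟨⟨m, h⟩, rfl⟩ := Quot.exists_rep f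
    exact isComposite_mk_of_mem_closure φ X (hXgen ▸ Submonoid.mem_top m) p q h
  exact ⟨key, _, finite_setOf_arrow_mk_mem φ hXfin, key⟩
end

section
/- Let K be an algebraically closed field and let S be a finitely generated, irreducible, periodic subsemigroup of the matrix semigroup M_n(K). Then S is finite. -/
open Polynomial

universe u

section EventuallyPeriodic

variable {K ι : Type*} [Field K] [Fintype ι] [DecidableEq ι]

theorem exists_lt_pow_eq_pow_of_finite_closure {M : Type*} [Monoid M] {s : M}
    (h : (Subsemigroup.closure {s} : Set M).Finite) : ∃ a b : ℕ, a < b ∧ s ^ a = s ^ b := by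
  have hmem : ∀ k : ℕ, s ^ (k + 1) ∈ Subsemigroup.closure {s} := by
    intro k
    induction k with
    | zero => simpa using Subsemigroup.subset_closure (Set.mem_singleton s)
    | succ k ih =>
      rw [pow_succ]
      exact mul_mem ih (Subsemigroup.subset_closure (Set.mem_singleton s))
  obtain ⟨a, b, hab, he⟩ := h.exists_lt_map_eq_of_forall_mem hmem
  exact ⟨a + 1, b + 1, by lia, he⟩

theorem Matrix.eq_zero_or_pow_eq_one_of_mem_spectrum {M : Matrix ι ι K} {a b : ℕ} (hab : a < b)
    (hM : M ^ a = M ^ b) {x : K} (hx : x ∈ spectrum K M) : x = 0 ∨ x ^ (b - a) = 1 := by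
  have h : x ^ b - x ^ a = 0 := by
    have h₁ := spectrum.subset_polynomial_aeval M (X ^ b - X ^ a : K[X]) ⟨x, hx, rfl⟩
    rcases isEmpty_or_nonempty ι with hι | hι
    · simp [spectrum.of_subsingleton] at hx
    · simpa [hM] using h₁
  rcases eq_or_ne x 0 with h0 | h0
  · exact .inl h0
  · refine .inr (mul_left_cancel₀ (pow_ne_zero a h0) ?_)
    rw [← pow_add, Nat.add_sub_cancel' hab.le, mul_one]
    exact sub_eq_zero.mp h

theorem Matrix.isIntegral_trace_of_pow_eq_pow (R : Type*) [CommRing R] [Algebra R K]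
    {M : Matrix ι ι K} {a b : ℕ} (hab : a < b) (hM : M ^ a = M ^ b) :
    IsIntegral R M.trace := by
  let f : K →ₐ[R] AlgebraicClosure K := IsScalarTower.toAlgHom R K (AlgebraicClosure K)
  have hf : Function.Injective f := (algebraMap K (AlgebraicClosure K)).injective
  rw [← isIntegral_algHom_iff f hf]
  have hM' : (f.mapMatrix M) ^ a = (f.mapMatrix M) ^ b := by
    rw [← map_pow, ← map_pow, hM]
  have ht : f M.trace = (f.mapMatrix M).trace := AddMonoidHom.map_trace f M
  rw [ht, Matrix.trace_eq_sum_roots_charpoly]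
  refine IsIntegral.multiset_sum fun x hx ↦ ?_
  rcases Matrix.eq_zero_or_pow_eq_one_of_mem_spectrum hab hM'
    (Matrix.mem_spectrum_of_isRoot_charpoly (isRoot_of_mem_roots hx)) with rfl | h
  · exact isIntegral_zero
  · exact IsIntegral.of_pow (Nat.sub_pos_of_lt hab) (h ▸ isIntegral_one)

theorem Matrix.norm_trace_le_card_of_pow_eq_pow
    {M : Matrix ι ι ℂ} {a b : ℕ} (hab : a < b) (hM : M ^ a = M ^ b) :
    ‖M.trace‖ ≤ Fintype.card ι := by
  rw [Matrix.trace_eq_sum_roots_charpoly]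
  have h : ∀ x ∈ M.charpoly.roots.map norm, x ≤ 1 := by
    intro y hy
    obtain ⟨x, hx, rfl⟩ := Multiset.mem_map.mp hy
    rcases Matrix.eq_zero_or_pow_eq_one_of_mem_spectrum hab hM
      (Matrix.mem_spectrum_of_isRoot_charpoly (isRoot_of_mem_roots hx)) with rfl | h
    · simp
    · exact (Complex.norm_eq_one_of_pow_eq_one h (Nat.sub_pos_of_lt hab).ne').le
  calc ‖M.charpoly.roots.sum‖ ≤ (M.charpoly.roots.map norm).sum := norm_multiset_sum_le _
    _ ≤ Multiset.card (M.charpoly.roots.map norm) • (1 : ℝ) := Multiset.sum_le_card_nsmul _ _ h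
    _ ≤ Fintype.card ι := by
      have := M.charpoly.card_roots'
      rw [M.charpoly_natDegree_eq_dim] at this
      simpa using this

/-- Over a number field, the matrices of a fixed size with an eventually periodic sequence of powers
have only finitely many traces. -/
theorem NumberField.finite_trace_of_pow_eq_pow (k ι : Type*) [Field k] [NumberField k]
    [Fintype ι] [DecidableEq ι] :
    {x : k | ∃ M : Matrix ι ι k, (∃ a b, a < b ∧ M ^ a = M ^ b) ∧ M.trace = x}.Finite := by
  refine (NumberField.Embeddings.finite_of_norm_le k ℂ (Fintype.card ι)).subset ?_
  rintro _ ⟨M, ⟨a, b, hab, hM⟩, rfl⟩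
  refine ⟨Matrix.isIntegral_trace_of_pow_eq_pow ℤ hab hM, fun φ ↦ ?_⟩
  have ht : φ M.trace = (φ.mapMatrix M).trace := AddMonoidHom.map_trace φ M
  rw [ht]
  refine Matrix.norm_trace_le_card_of_pow_eq_pow hab ?_
  rw [← map_pow, ← map_pow, hM]

/-- A finitely generated domain over a field `F` has a residue field, finite over `F`, to which
distinct integral elements reduce to distinct elements. -/
theorem exists_finite_algHom_injOn_isIntegral (F : Type*) {R : Type*} [Field F]
    [CommRing R] [IsDomain R] [Algebra F R] [Algebra.FiniteType F R] :
    ∃ m : Ideal R, ∃ _ : m.IsMaximal, Module.Finite F (R ⧸ m) ∧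
      Set.InjOn (Ideal.Quotient.mk m) {x | IsIntegral F x} := by
  obtain ⟨m, hm⟩ := Ideal.exists_maximal R
  refine ⟨m, hm, ?_, ?_⟩
  · let := Ideal.Quotient.field m
    exact finite_of_finite_type_of_isJacobsonRing F (R ⧸ m)
  · intro x hx y hy hxy
    by_contra hne
    exact hm.ne_top (m.eq_top_of_isUnit_mem (Ideal.Quotient.eq.mp hxy)
      (IsArtinianRing.isUnit_of_isIntegral_of_nonZeroDivisor (IsIntegral.sub hx hy)
        (mem_nonZeroDivisors_of_ne_zero (sub_ne_zero.mpr hne))))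

/-- If matrices over finite extensions of `F` with eventually periodic powers have finitely many
traces, then so do the matrices with entries in a finitely generated `F`-algebra. -/
theorem finite_trace_of_finite_extension {K : Type u} (F : Type*) {ι : Type*} [Field F] [Field K]
    [Algebra F K] [Fintype ι] [DecidableEq ι]
    (hF : ∀ (k : Type u) [Field k] [Algebra F k] [Module.Finite F k],
      {x : k | ∃ M : Matrix ι ι k, (∃ a b, a < b ∧ M ^ a = M ^ b) ∧ M.trace = x}.Finite)
    {X : Set (Matrix ι ι K)} (hX : X.Finite) :
    (Matrix.trace '' {s : Matrix ι ι K | s ∈ Subsemigroup.closure X ∧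
      ∃ a b, a < b ∧ s ^ a = s ^ b}).Finite := by
  let E : Set K := ⋃ s ∈ X, Set.range fun p : ι × ι ↦ s p.1 p.2
  have hE : E.Finite := hX.biUnion fun s _ ↦ Set.finite_range _
  let R : Subalgebra F K := Algebra.adjoin F E
  have : Algebra.FiniteType F R := by
    rw [← Subalgebra.fg_iff_finiteType]
    exact Subalgebra.fg_def.mpr ⟨E, hE, rfl⟩
  have hR : ∀ s ∈ Subsemigroup.closure X, ∃ s' : Matrix ι ι R, R.val.mapMatrix s' = s := by
    intro s hs
    induction hs using Subsemigroup.closure_induction with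
    | mem s hs =>
      exact ⟨fun i j ↦ ⟨s i j, Algebra.subset_adjoin
        (Set.mem_biUnion hs ⟨(i, j), rfl⟩)⟩, rfl⟩
    | mul s t _ _ hs ht =>
      obtain ⟨s', rfl⟩ := hs
      obtain ⟨t', rfl⟩ := ht
      exact ⟨s' * t', map_mul _ _ _⟩
  have hinj : Function.Injective (R.val.mapMatrix (m := ι)) := by
    intro s t h
    ext i j
    exact congr_fun₂ h i j
  obtain ⟨m, hm, hfin, hmi⟩ := exists_finite_algHom_injOn_isIntegral F (R := R)
  let := Ideal.Quotient.field m
  let T : Set R := {x | IsIntegral F x ∧ Ideal.Quotient.mk m x ∈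
    {x : R ⧸ m | ∃ M : Matrix ι ι (R ⧸ m), (∃ a b, a < b ∧ M ^ a = M ^ b) ∧ M.trace = x}}
  have hT : T.Finite := Set.Finite.of_finite_image ((hF (R ⧸ m)).subset (by
    rintro _ ⟨x, hx, rfl⟩
    exact hx.2)) (hmi.mono fun x hx ↦ hx.1)
  refine (hT.image R.val).subset ?_
  rintro _ ⟨s, ⟨hs, a, b, hab, h⟩, rfl⟩
  obtain ⟨s', rfl⟩ := hR s hs
  have h' : s' ^ a = s' ^ b := hinj (by rw [map_pow, map_pow, h])
  have ht : R.val s'.trace = (R.val.mapMatrix s').trace := AddMonoidHom.map_trace R.val s'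
  refine ⟨s'.trace, ⟨?_, (Ideal.Quotient.mk m).mapMatrix s', ⟨a, b, hab, ?_⟩, ?_⟩, ht⟩
  · rw [← isIntegral_algHom_iff R.val Subtype.val_injective, ht]
    exact Matrix.isIntegral_trace_of_pow_eq_pow F hab h
  · rw [← map_pow, ← map_pow, h']
  · exact (AddMonoidHom.map_trace (Ideal.Quotient.mk m) s').symm

theorem finite_trace_of_closure {X : Set (Matrix ι ι K)} (hX : X.Finite) :
    (Matrix.trace '' {s : Matrix ι ι K | s ∈ Subsemigroup.closure X ∧
      ∃ a b, a < b ∧ s ^ a = s ^ b}).Finite := by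
  obtain ⟨p, hp⟩ := CharP.exists K
  rcases CharP.char_is_prime_or_zero K p with hprime | rfl
  · have : Fact p.Prime := ⟨hprime⟩
    let := ZMod.algebra K p
    refine finite_trace_of_finite_extension (ZMod p) (fun k _ _ _ ↦ ?_) hX
    have : Finite k := Module.finite_of_finite (ZMod p)
    exact Set.toFinite _
  · have := CharP.charP_to_charZero K
    refine finite_trace_of_finite_extension ℚ (fun k _ _ _ ↦ ?_) hX
    have : CharZero k := algebraRat.charZero k
    have : NumberField k :=
      { to_finiteDimensional := by convert! ‹Module.Finite ℚ k›; exact Subsingleton.elim _ _ }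
    exact NumberField.finite_trace_of_pow_eq_pow k ι

end EventuallyPeriodic

section Burnside

/-- **Burnside's theorem**: an irreducible algebra of endomorphisms of a finite-dimensional vector
space over an algebraically closed field contains all endomorphisms. -/
theorem Subalgebra.eq_top_of_irreducible {K V : Type*} [Field K] [IsAlgClosed K] [AddCommGroup V]
    [Module K V] [FiniteDimensional K V] [Nontrivial V] (A : Subalgebra K (Module.End K V))
    (hA : ∀ W : Submodule K V, (∀ a ∈ A, ∀ v ∈ W, a v ∈ W) → W = ⊥ ∨ W = ⊤) : A = ⊤ := by
  have : IsSimpleModule A V :=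
    { eq_bot_or_eq_top := fun W ↦ by
        rcases hA (W.restrictScalars K) (fun a ha v hv ↦ W.smul_mem (⟨a, ha⟩ : A) hv) with h | h
        · exact .inl ((Submodule.restrictScalars_eq_bot_iff K A V).mp h)
        · exact .inr ((Submodule.restrictScalars_eq_top_iff K A V).mp h) }
  have hschur := (IsSimpleModule.algebraMap_end_bijective_of_isAlgClosed (A := A) (V := V) K).2
  refine eq_top_iff.mpr fun f _ ↦ ?_
  let g : Module.End (Module.End A V) V :=
    { toFun := f
      map_add' := map_add f
      map_smul' := fun c v ↦ by
        obtain ⟨r, rfl⟩ := hschur c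
        exact map_smul f r v }
  obtain ⟨s, hs⟩ := Module.Finite.fg_top (R := K) (M := V)
  obtain ⟨r, hr⟩ := jacobson_density g s
  have : f = r := LinearMap.ext_on hs fun v hv ↦ hr v hv
  exact this ▸ r.2

variable {K ι : Type*} [Field K] [IsAlgClosed K] [Fintype ι] [DecidableEq ι]

theorem Matrix.adjoin_eq_top_of_irreducible [Nonempty ι] {S : Set (Matrix ι ι K)}
    (hS : ∀ W : Submodule K (ι → K),
      (∀ s ∈ S, ∀ v ∈ W, s.mulVec v ∈ W) → W = ⊥ ∨ W = ⊤) : Algebra.adjoin K S = ⊤ := by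
  let e : Matrix ι ι K ≃ₐ[K] Module.End K (ι → K) := Matrix.toLinAlgEquiv'
  have h : (Algebra.adjoin K S).map e.toAlgHom = ⊤ :=
    Subalgebra.eq_top_of_irreducible _ fun W hW ↦ hS W fun s hs v hv ↦ by
      simpa [e] using hW (e s) ⟨s, Algebra.subset_adjoin hs, rfl⟩ v hv
  refine eq_top_iff.mpr fun x _ ↦ ?_
  obtain ⟨y, hy, hyx⟩ : e x ∈ (Algebra.adjoin K S).map e.toAlgHom := h ▸ Algebra.mem_top
  exact e.injective hyx ▸ hy

theorem Matrix.span_eq_top_of_irreducible [Nonempty ι] (S : Subsemigroup (Matrix ι ι K))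
    (hS : ∀ W : Submodule K (ι → K),
      (∀ s ∈ S, ∀ v ∈ W, s.mulVec v ∈ W) → W = ⊥ ∨ W = ⊤) {s₀ : Matrix ι ι K} (hs₀ : s₀ ∈ S)
    (h₀ : s₀ ≠ 0) : Submodule.span K (S : Set (Matrix ι ι K)) = ⊤ := by
  have hadj := Matrix.adjoin_eq_top_of_irreducible hS
  set P := Submodule.span K (S : Set (Matrix ι ι K)) with hP
  have hmul : ∀ x ∈ P, ∀ y ∈ P, x * y ∈ P := by
    intro x hx y hy
    have h := Submodule.mul_mem_mul hx hy
    rw [hP, Submodule.span_mul_span] at h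
    refine Submodule.span_mono ?_ h
    rintro _ ⟨s, hs, t, ht, rfl⟩
    exact S.mul_mem hs ht
  have hideal : ∀ x, ∀ y ∈ P, x * y ∈ P ∧ y * x ∈ P := by
    intro x
    have hx : x ∈ Algebra.adjoin K (S : Set (Matrix ι ι K)) := hadj ▸ Algebra.mem_top
    induction hx using Algebra.adjoin_induction with
    | mem x hx =>
      have hx := Submodule.subset_span (R := K) hx
      exact fun y hy ↦ ⟨hmul x hx y hy, hmul y hy x hx⟩
    | algebraMap r =>
      intro y hy
      rw [← Algebra.commutes, ← Algebra.smul_def]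
      exact ⟨P.smul_mem r hy, P.smul_mem r hy⟩
    | add x z _ _ hx hz =>
      intro y hy
      rw [add_mul, mul_add]
      exact ⟨P.add_mem (hx y hy).1 (hz y hy).1, P.add_mem (hx y hy).2 (hz y hy).2⟩
    | mul x z _ _ hx hz =>
      intro y hy
      rw [mul_assoc, ← mul_assoc y]
      exact ⟨(hx _ (hz y hy).1).1, (hz _ (hx y hy).2).2⟩
  let I : TwoSidedIdeal (Matrix ι ι K) := .mk' P P.zero_mem P.add_mem P.neg_mem
    (fun {x y} hy ↦ (hideal x y hy).1) (fun {x y} hx ↦ (hideal y x hx).2)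
  have hI : ∀ x, x ∈ I ↔ x ∈ P := fun x ↦ TwoSidedIdeal.mem_mk' ..
  rcases eq_bot_or_eq_top I with h | h
  · have := (hI s₀).mpr (Submodule.subset_span hs₀)
    rw [h, TwoSidedIdeal.mem_bot] at this
    exact absurd this h₀
  · exact eq_top_iff.mpr fun x _ ↦ (hI x).mp (h ▸ trivial)

end Burnside

/-- A subsemigroup spanning the matrix algebra and having finitely many traces is finite. -/
theorem Subsemigroup.finite_of_finite_trace {K ι : Type*} [Field K] [Fintype ι] [DecidableEq ι]
    (S : Subsemigroup (Matrix ι ι K)) (hspan : Submodule.span K (S : Set (Matrix ι ι K)) = ⊤)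
    (htr : (Matrix.trace '' (S : Set (Matrix ι ι K))).Finite) :
    (S : Set (Matrix ι ι K)).Finite := by
  obtain ⟨B, hBS, hB⟩ := (Submodule.fg_span_iff_fg_span_finset_subset (R := K)
    (S : Set (Matrix ι ι K))).mp (IsNoetherian.noetherian _)
  let f : Matrix ι ι K → B → K := fun s b ↦ (s * b).trace
  have hf : (f '' S).Finite := (Set.Finite.pi' fun _ : B ↦ htr).subset (by
    rintro _ ⟨s, hs, rfl⟩ b
    exact ⟨s * b, S.mul_mem hs (hBS b.2), rfl⟩)
  refine Set.Finite.of_finite_image hf fun s _ t _ hst ↦ ?_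
  rw [Matrix.ext_iff_trace_mul_right]
  intro x
  have hx : x ∈ Submodule.span K (B : Set (Matrix ι ι K)) := by
    rw [← hB, hspan]
    trivial
  exact LinearMap.eqOn_span (f := Matrix.traceLinearMap ι K K ∘ₗ LinearMap.mulLeft K s)
    (g := Matrix.traceLinearMap ι K K ∘ₗ LinearMap.mulLeft K t)
    (fun b hb ↦ congr_fun hst ⟨b, hb⟩) hx

/-- **Proposition.** A finitely generated, irreducible, periodic subsemigroup of the
multiplicative semigroup of `n × n` matrices over an algebraically closed field is
finite. -/
theorem irreducible_periodic_fg_matrix_subsemigroup_finite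
    {K : Type*} [Field K] [IsAlgClosed K] {n : ℕ}
    (S : Subsemigroup (Matrix (Fin n) (Fin n) K))
    (hfg : ∃ X : Set (Matrix (Fin n) (Fin n) K), X.Finite ∧ Subsemigroup.closure X = S)
    (hper : ∀ s ∈ S, (Subsemigroup.closure {s} : Set (Matrix (Fin n) (Fin n) K)).Finite)
    (hirr : ∀ W : Submodule K (Fin n → K),
      (∀ s ∈ S, ∀ v ∈ W, s.mulVec v ∈ W) → W = ⊥ ∨ W = ⊤) :
    (S : Set (Matrix (Fin n) (Fin n) K)).Finite := by
  obtain ⟨X, hX, rfl⟩ := hfg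
  by_cases h : ∃ s ∈ Subsemigroup.closure X, s ≠ 0
  · obtain ⟨s₀, hs₀, h₀⟩ := h
    have : Nonempty (Fin n) := by
      by_contra hn
      rw [not_nonempty_iff] at hn
      exact h₀ (Subsingleton.elim _ _)
    refine Subsemigroup.finite_of_finite_trace _
      (Matrix.span_eq_top_of_irreducible _ hirr hs₀ h₀)
      ((finite_trace_of_closure hX).subset (Set.image_mono fun s hs ↦
        ⟨hs, exists_lt_pow_eq_pow_of_finite_closure (hper s hs)⟩))
  · push Not at h
    exact (Set.finite_singleton 0).subset h
end

section
/- Let K be a ring with unit and let M ⊆ M_n(K) be a monoid of block upper triangular matrices of the form [[A, B],[0, C]] with A ∈ M_m(K), C ∈ M_r(K) (m + r = n). Let φ be the projection of M to the pair of diagonal blocks and set N = φ(M). Then for all n₁, n₂ ∈ N, the trace monoid tr_φ(n₁,n₂) embeds in the additive group of m × r matrices M_{m,r}(K); explicitly, writing n₁ = (X,Y) and n₂ = (U,V), the map sending the class of m = [[A,B],[0,C]] (with n₁·φ(m) = n₁ and φ(m)·n₂ = n₂) to X·B·V is a well-defined injective monoid homomorphism from tr_φ(n₁,n₂) to (M_{m,r}(K),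 +). -/
namespace Matrix

theorem toBlocks₁₂_mul {l m n o p k R : Type*} [Fintype l] [Fintype m]
    [NonUnitalNonAssocSemiring R] (a : Matrix (o ⊕ p) (l ⊕ m) R)
    (b : Matrix (l ⊕ m) (n ⊕ k) R) :
    (a * b).toBlocks₁₂ = a.toBlocks₁₁ * b.toBlocks₁₂ + a.toBlocks₁₂ * b.toBlocks₂₂ := by
  ext i j
  simp [toBlocks₁₁, toBlocks₁₂, toBlocks₂₂, mul_apply, Fintype.sum_sum_type]

end Matrix

/-- **Lemma.** Let `K` be a ring with unit and `M` a monoid of block upper triangular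
matrices `[[A, B], [0, C]]` (indexed by `Fin m ⊕ Fin r`).  Let `φ` be the projection of `M`
to the pair of diagonal blocks and `N = φ(M)`.  Then for all `n₁, n₂ ∈ N` the trace monoid
`tr_φ(n₁, n₂)` embeds in the additive group of `m × r` matrices:  writing `n₁ = (X, Y)` and
`n₂ = (U, V)`, the map sending the class of `[[A, B], [0, C]]` to `X·B·V` is a well-defined
injective homomorphism from `tr_φ(n₁, n₂)` (multiplicative) to `(M_{m,r}(K), +)`. -/
theorem traceMonoid_embeds_in_additive_matrices
    {K : Type*} [Ring K] {m r : ℕ}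
    (M : Submonoid (Matrix (Fin m ⊕ Fin r) (Fin m ⊕ Fin r) K))
    (hM : ∀ s ∈ M, ∀ (i : Fin r) (j : Fin m), s (Sum.inr i) (Sum.inl j) = 0)
    (φ : M →* Matrix (Fin m) (Fin m) K × Matrix (Fin r) (Fin r) K)
    (hφ : ∀ s : M, φ s = ((s : Matrix (Fin m ⊕ Fin r) (Fin m ⊕ Fin r) K).toBlocks₁₁,
      (s : Matrix (Fin m ⊕ Fin r) (Fin m ⊕ Fin r) K).toBlocks₂₂))
    (n₁ n₂ : Matrix (Fin m) (Fin m) K × Matrix (Fin r) (Fin r) K)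
    (h₁ : n₁ ∈ MonoidHom.mrange φ) (h₂ : n₂ ∈ MonoidHom.mrange φ) :
    ∃ ψ : traceMonoid φ n₁ n₂ → Matrix (Fin m) (Fin r) K,
      Function.Injective ψ ∧ ψ 1 = 0 ∧ (∀ a b, ψ (a * b) = ψ a + ψ b) ∧
      ∀ s : traceSubmonoid φ n₁ n₂,
        ψ ((traceCon φ n₁ n₂).mk' s) =
          n₁.1 * ((s : M) : Matrix (Fin m ⊕ Fin r) (Fin m ⊕ Fin r) K).toBlocks₁₂ * n₂.2 := by
  have hφ₁ (s : M) : (s : Matrix (Fin m ⊕ Fin r) (Fin m ⊕ Fin r) K).toBlocks₁₁ = (φ s).1 := by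
    rw [hφ]
  have hφ₂ (s : M) : (s : Matrix (Fin m ⊕ Fin r) (Fin m ⊕ Fin r) K).toBlocks₂₂ = (φ s).2 := by
    rw [hφ]
  have hX (s : traceSubmonoid φ n₁ n₂) : n₁.1 * (φ s).1 = n₁.1 := congrArg Prod.fst s.2.1
  have hV (s : traceSubmonoid φ n₁ n₂) : (φ s).2 * n₂.2 = n₂.2 := congrArg Prod.snd s.2.2
  have corner (s : traceSubmonoid φ n₁ n₂) (p q : M) (hp : φ p = n₁) (hq : φ q = n₂) :
      ((p * s * q : M) : Matrix (Fin m ⊕ Fin r) (Fin m ⊕ Fin r) K).toBlocks₁₂ =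
        n₁.1 * (q : Matrix (Fin m ⊕ Fin r) (Fin m ⊕ Fin r) K).toBlocks₁₂ +
        (n₁.1 * ((s : M) : Matrix (Fin m ⊕ Fin r) (Fin m ⊕ Fin r) K).toBlocks₁₂ * n₂.2 +
        (p : Matrix (Fin m ⊕ Fin r) (Fin m ⊕ Fin r) K).toBlocks₁₂ * n₂.2) := by
    rw [Submonoid.coe_mul, Matrix.toBlocks₁₂_mul, hφ₁, hφ₂, hq, map_mul, hp, s.2.1,
      Submonoid.coe_mul, Matrix.toBlocks₁₂_mul, hφ₁, hφ₂, hp, Matrix.add_mul,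
      Matrix.mul_assoc _ (φ s).2, hV]
  have hcon (a b : traceSubmonoid φ n₁ n₂) : traceCon φ n₁ n₂ a b ↔
      n₁.1 * ((a : M) : Matrix (Fin m ⊕ Fin r) (Fin m ⊕ Fin r) K).toBlocks₁₂ * n₂.2 =
      n₁.1 * ((b : M) : Matrix (Fin m ⊕ Fin r) (Fin m ⊕ Fin r) K).toBlocks₁₂ * n₂.2 := by
    constructor
    · intro h
      obtain ⟨p, hp⟩ := h₁
      obtain ⟨q, hq⟩ := h₂
      have := congrArg (fun s : M =>
        (s : Matrix (Fin m ⊕ Fin r) (Fin m ⊕ Fin r) K).toBlocks₁₂) (h p q hp hq)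
      simpa only [corner _ p q hp hq, add_left_cancel_iff, add_right_cancel_iff] using this
    · intro h p q hp hq
      have hdiag : φ (p * a * q) = φ (p * b * q) := by
        rw [map_mul, map_mul, hp, a.2.1, map_mul, map_mul, hp, b.2.1]
      apply Subtype.ext
      rw [Matrix.ext_iff_blocks]
      refine ⟨?_, ?_, ?_, ?_⟩
      · rw [hφ₁, hφ₁, hdiag]
      · rw [corner a p q hp hq, corner b p q hp hq, h]
      · ext i j
        exact (hM _ (p * a * q).2 i j).trans (hM _ (p * b * q).2 i j).symm
      · rw [hφ₂, hφ₂, hdiag]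
  refine ⟨Quotient.lift (s := (traceCon φ n₁ n₂).toSetoid)
    (fun s => n₁.1 * ((s : M) : Matrix (Fin m ⊕ Fin r) (Fin m ⊕ Fin r) K).toBlocks₁₂ * n₂.2)
    fun a b h => (hcon a b).1 h, ?_, ?_, ?_, fun _ => rfl⟩
  · rintro ⟨a⟩ ⟨b⟩ h
    exact Quotient.sound ((hcon a b).2 h)
  · change n₁.1 * (1 : Matrix (Fin m ⊕ Fin r) (Fin m ⊕ Fin r) K).toBlocks₁₂ * n₂.2 = 0
    rw [← Matrix.fromBlocks_one, Matrix.toBlocks_fromBlocks₁₂, Matrix.mul_zero, Matrix.zero_mul]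
  · rintro ⟨a⟩ ⟨b⟩
    change n₁.1 * (((a : M) : Matrix (Fin m ⊕ Fin r) (Fin m ⊕ Fin r) K) *
      ((b : M) : Matrix (Fin m ⊕ Fin r) (Fin m ⊕ Fin r) K)).toBlocks₁₂ * n₂.2 =
      n₁.1 * ((a : M) : Matrix (Fin m ⊕ Fin r) (Fin m ⊕ Fin r) K).toBlocks₁₂ * n₂.2 +
      n₁.1 * ((b : M) : Matrix (Fin m ⊕ Fin r) (Fin m ⊕ Fin r) K).toBlocks₁₂ * n₂.2
    rw [Matrix.toBlocks₁₂_mul, hφ₁, hφ₂, Matrix.mul_add, Matrix.add_mul, ← Matrix.mul_assoc, hX,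
      ← Matrix.mul_assoc n₁.1, Matrix.mul_assoc _ (φ b).2, hV, add_comm]
end

section
/- Let K be a field and let S be a finitely generated periodic subsemigroup of the matrix semigroup M_n(K). Then S is finite. -/
instance Int.instIsJacobsonRing : IsJacobsonRing ℤ := by
  rw [isJacobsonRing_iff_prime_eq]
  intro P hP
  by_cases h : P = ⊥
  · subst h
    refine le_antisymm (fun x hx => ?_) Ideal.le_jacobson
    have hx' := Ideal.mem_jacobson_bot.1 hx x
    rw [Int.isUnit_iff] at hx'
    rcases hx' with h | h <;> simp only [Ideal.mem_bot] <;> nlinarith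
  · exact Ideal.jacobson_eq_self_of_isMaximal (H := hP.isMaximal h)

/-- A field which is finitely generated as a ring is finite. -/
theorem finite_of_finiteType_int (F : Type*) [Field F] [alg : Algebra ℤ F]
    [Algebra.FiniteType ℤ F] : Finite F := by
  obtain rfl : alg = Ring.toIntAlgebra F := Subsingleton.elim _ _
  have hfin : Module.Finite ℤ F := finite_of_finite_type_of_isJacobsonRing ℤ F
  obtain ⟨p, hp⟩ := CharP.exists F
  have hp0 : p ≠ 0 := by
    rintro rfl
    have : CharZero F := CharP.charP_to_charZero F
    exact Int.not_isField (isField_of_isIntegral_of_isField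
      (FaithfulSMul.algebraMap_injective ℤ F) (Field.toIsField F))
  refine Module.finite_of_fg_torsion F ?_
  intro x
  refine ⟨⟨(p : ℤ), mem_nonZeroDivisors_of_ne_zero (by exact_mod_cast hp0)⟩, ?_⟩
  change (p : ℤ) • x = 0
  simp

theorem exists_pow_prime_pow_eq_one {C L : Type*} [CommRing C] [IsDomain C] [Field L]
    (f : C →+* L) (p : ℕ) [CharP L p] (hp : p.Prime) {x : C} (hx : f x = 1)
    {k : ℕ} (hk : 0 < k) (hxk : x ^ k = 1) : ∃ e, x ^ p ^ e = 1 := by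
  obtain ⟨e, m, hm, rfl⟩ := Nat.exists_eq_pow_mul_and_not_dvd hk.ne' p hp.ne_one
  refine ⟨e, ?_⟩
  by_contra hne
  have h0 : ∑ i ∈ Finset.range m, (x ^ p ^ e) ^ i = 0 := by
    have := geom_sum_mul (x ^ p ^ e) m
    rw [← pow_mul x, hxk, sub_self] at this
    exact (mul_eq_zero.1 this).resolve_right (sub_ne_zero.2 hne)
  have := congrArg f h0
  simp only [map_sum, map_pow, hx, one_pow, Finset.sum_const, Finset.card_range, nsmul_eq_mul,
    mul_one, map_zero] at this
  exact hm ((CharP.cast_eq_zero_iff L p m).1 this)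

theorem exists_pow_add_eq_pow (M : Type*) [Monoid M] [Finite M] :
    ∃ i N : ℕ, 0 < N ∧ ∀ x : M, x ^ (i + N) = x ^ i := by
  refine ⟨Nat.card M, (Nat.card M).factorial, Nat.factorial_pos _, fun x => ?_⟩
  obtain ⟨a, b, hab, hxab⟩ : ∃ a b : Fin (Nat.card M + 1), a < b ∧ x ^ (a : ℕ) = x ^ (b : ℕ) := by
    have : ¬ Function.Injective (fun a : Fin (Nat.card M + 1) => x ^ (a : ℕ)) := fun h => by
      have := Nat.card_le_card_of_injective _ h
      simp at this
    simp only [Function.Injective, not_forall] at this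
    obtain ⟨a, b, h, hne⟩ := this
    rcases lt_or_gt_of_ne hne with h' | h'
    exacts [⟨a, b, h', h⟩, ⟨b, a, h', h.symm⟩]
  have key : ∀ c d : ℕ, a ≤ c → x ^ (c + d * (b - a : ℕ)) = x ^ c := by
    intro c d hc
    induction d with
    | zero => simp
    | succ d ih =>
      have e1 : c + (d + 1) * (b - a : ℕ) = b + (c - a + d * (b - a : ℕ)) := by
        have : (a : ℕ) < b := hab
        rw [add_mul]; omega
      have e2 : c + d * (b - a : ℕ) = a + (c - a + d * (b - a : ℕ)) := by omega
      rw [e1, pow_add, ← hxab, ← pow_add, ← e2, ih]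
  obtain ⟨d, hd⟩ : (b - a : ℕ) ∣ (Nat.card M).factorial :=
    Nat.dvd_factorial (Nat.sub_pos_of_lt hab) (by omega)
  rw [hd, mul_comm]
  exact key _ _ (by omega)

open scoped Pointwise in
theorem finite_nsmul {A : Type*} [AddMonoid A] {D : Set A} (hD : D.Finite) (n : ℕ) :
    (n • D).Finite := by
  induction n with
  | zero => simp
  | succ n ih => exact succ_nsmul D n ▸ ih.add hD

open scoped Pointwise in
theorem mem_card_nsmul_of_steps {σ A : Type*} [AddCommGroup A] [DecidableEq σ] (D : Set A)
    (c : ℕ → σ) (F : ℕ → A) (k : ℕ) (h0 : F 0 = 0) (hstep : ∀ i < k, F (i + 1) - F i ∈ D)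
    (hloop : ∀ i j, i ≤ j → j ≤ k → c i = c j → F i = F j) :
    ∀ i ≤ k, F i ∈ ((Finset.range (i + 1)).image c).card • insert 0 D := by
  intro i
  induction i using Nat.strong_induction_on with
  | _ i ih =>
    intro hi
    by_cases hrep : ∃ j < i, c j = c i
    · obtain ⟨j, hj, hji⟩ := hrep
      rw [← hloop j i hj.le hi hji]
      refine Set.nsmul_subset_nsmul_right (Set.mem_insert 0 D) ?_ (ih j hj (by omega))
      gcongr
    · cases i with
      | zero => simp [h0]
      | succ i =>
        have hnot : c (i + 1) ∉ (Finset.range (i + 1)).image c := by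
          simpa using fun j hj h => hrep ⟨j, hj, h⟩
        rw [Finset.range_add_one, Finset.image_insert, Finset.card_insert_of_notMem hnot,
          succ_nsmul]
        exact Set.mem_add.2 ⟨_, ih i (by omega) (by omega), _,
          Set.mem_insert_of_mem _ (hstep i hi), add_sub_cancel _ _⟩

theorem finite_closure_of_nsmul_eq_zero {A : Type*} [AddCommGroup A] {p : ℕ} (hp : 0 < p)
    (hA : ∀ x : A, p • x = 0) {D : Set A} (hD : D.Finite) :
    (AddSubgroup.closure D : Set A).Finite := by
  have : Finite D := hD
  have hfg : AddGroup.FG (AddSubgroup.closure D) := AddGroup.closure_finite_fg D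
  exact AddCommGroup.finite_of_fg_isAddTorsion (AddSubgroup.closure D) fun x =>
    isOfFinAddOrder_iff_nsmul_eq_zero.2 ⟨p, hp, Subtype.ext (hA x)⟩

section Peirce

variable {E M : Type*} [Ring E] [Monoid M] {ρ : M →* E} {P : E}

theorem mul_map_pow_mul_eq_nsmul (hP : P * P = P) (hρ : ∀ m, (1 - P) * ρ m * P = 0) {u s v : M}
    (hu : ρ (u * s) * P = ρ u * P) (hv : (1 - P) * ρ (s * v) = (1 - P) * ρ v) (n : ℕ) :
    ρ u * P * ρ (s ^ n) * ((1 - P) * ρ v) = n • (ρ u * P * ρ s * ((1 - P) * ρ v)) := by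
  have hPρ : ∀ m, P * ρ m * P = ρ m * P := fun m => by
    have := hρ m
    rw [sub_mul, sub_mul, one_mul, sub_eq_zero] at this
    exact this.symm
  have hQρ : ∀ m, (1 - P) * ρ m * (1 - P) = (1 - P) * ρ m := fun m => by
    rw [mul_sub, hρ, mul_one, sub_zero]
  have hv' : ∀ n : ℕ, (1 - P) * ρ (s ^ n * v) = (1 - P) * ρ v := by
    intro n
    induction n with
    | zero => simp
    | succ n ih =>
      rw [pow_succ, mul_assoc, map_mul, ← mul_assoc, ← hQρ, mul_assoc _ _ (ρ (s * v)), hv,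
        ← mul_assoc, hQρ, mul_assoc, ← map_mul, ih]
  induction n with
  | zero =>
    have : P * (1 - P) = 0 := by rw [mul_sub, mul_one, hP, sub_self]
    rw [pow_zero, map_one, mul_one, zero_nsmul, ← mul_assoc, mul_assoc (ρ u), this]
    simp
  | succ n ih =>
    have e1 : ρ u * P * ρ s * P = ρ u * P := by
      rw [mul_assoc (ρ u), mul_assoc (ρ u), hPρ, ← mul_assoc, ← map_mul, hu]
    have e2 : (1 - P) * ρ (s ^ n) * ((1 - P) * ρ v) = (1 - P) * ρ v := by
      rw [← mul_assoc, hQρ, mul_assoc, ← map_mul, hv']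
    calc ρ u * P * ρ (s ^ (n + 1)) * ((1 - P) * ρ v)
        = ρ u * P * ρ s * P * ρ (s ^ n) * ((1 - P) * ρ v)
          + ρ u * P * ρ s * ((1 - P) * ρ (s ^ n) * ((1 - P) * ρ v)) := by
          rw [pow_succ', map_mul]; noncomm_ring
      _ = _ := by rw [e1, e2, ih, succ_nsmul]

theorem peirce_difference (hρ : ∀ m, (1 - P) * ρ m * P = 0) (u s v : M) :
    P * ρ (u * s) * (1 - P) * ρ v - P * ρ u * (1 - P) * ρ (s * v) =
      ρ u * P * ρ s * ((1 - P) * ρ v) := by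
  have hPρ : P * ρ u * P = ρ u * P := by
    have := hρ u
    rw [sub_mul, sub_mul, one_mul, sub_eq_zero] at this
    exact this.symm
  have hQρ : (1 - P) * ρ s = (1 - P) * ρ s * (1 - P) := by
    rw [mul_sub, hρ, mul_one, sub_zero]
  calc _ = P * ρ u * ρ s * (1 - P) * ρ v - P * ρ u * ((1 - P) * ρ s) * ρ v := by
        simp only [map_mul, mul_assoc]
    _ = P * ρ u * P * ρ s * ((1 - P) * ρ v) := by rw [hQρ]; noncomm_ring
    _ = _ := by rw [hPρ]

open scoped Pointwise in
/-- A periodic finitely generated monoid of block upper triangular operators with finitely many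
diagonal blocks is finite. -/
theorem finite_range_of_peirce [Monoid.FG M]
    (hM : ∀ m : M, ∃ i j : ℕ, i < j ∧ m ^ i = m ^ j)
    (hE : IsAddTorsionFree E ∨ ∃ p : ℕ, 0 < p ∧ ∀ x : E, p • x = 0)
    (hP : P * P = P) (hρ : ∀ m, (1 - P) * ρ m * P = 0)
    (ha : (Set.range fun m => ρ m * P).Finite) (hb : (Set.range fun m => (1 - P) * ρ m).Finite) :
    (Set.range ρ).Finite := by
  classical
  obtain ⟨X, hX⟩ := Monoid.FG.fg_top (M := M)
  set a := Set.range fun m => ρ m * P with ha_def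
  set b := Set.range fun m => (1 - P) * ρ m with hb_def
  set D : Set E := a * ρ '' X * b with hD_def
  have hD : D.Finite := (ha.mul (X.finite_toSet.image ρ)).mul hb
  suffices h : ∃ B : Set E, B.Finite ∧ ∀ m, P * ρ m * (1 - P) ∈ B by
    obtain ⟨B, hB, hmB⟩ := h
    refine ((ha.add hB).add hb).subset ?_
    rintro _ ⟨m, rfl⟩
    have : ρ m = ρ m * P + P * ρ m * (1 - P) + (1 - P) * ρ m := by
      have h1 : (1 - P) * ρ m * P = 0 := hρ m
      calc ρ m = ρ m * P + P * ρ m * (1 - P) + (1 - P) * ρ m - (1 - P) * ρ m * P := by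
            noncomm_ring
        _ = _ := by rw [h1, sub_zero]
    rw [this]
    exact Set.add_mem_add (Set.add_mem_add ⟨m, rfl⟩ (hmB m)) ⟨m, rfl⟩
  have key : ∀ m, ∃ (k : ℕ) (u v : ℕ → M), u 0 = 1 ∧ u k = m ∧ v k = 1 ∧
      (∀ i < k, ∃ x ∈ X, u (i + 1) = u i * x ∧ v i = x * v (i + 1)) := by
    intro m
    obtain ⟨l, hl, rfl⟩ := Submonoid.exists_list_of_mem_closure (hX ▸ Submonoid.mem_top m)
    refine ⟨l.length, fun i => (l.take i).prod, fun i => (l.drop i).prod, by simp, by simp,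
      by simp, fun i hi => ⟨l[i], hl _ (List.getElem_mem hi), ?_, ?_⟩⟩
    · exact List.prod_take_succ l i hi
    · change (l.drop i).prod = _
      rw [List.drop_eq_getElem_cons hi, List.prod_cons]
  have hF0 : ∀ m, P * ρ 1 * (1 - P) * ρ m = 0 := fun m => by
    rw [map_one, mul_one, mul_sub, mul_one, hP, sub_self, zero_mul]
  have hstep : ∀ (k : ℕ) (u v : ℕ → M),
      (∀ i < k, ∃ x ∈ X, u (i + 1) = u i * x ∧ v i = x * v (i + 1)) → ∀ i < k,
      P * ρ (u (i + 1)) * (1 - P) * ρ (v (i + 1)) - P * ρ (u i) * (1 - P) * ρ (v i) ∈ D := by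
    intro k u v huv i hi
    obtain ⟨x, hx, h1, h2⟩ := huv i hi
    rw [h1, h2, peirce_difference hρ]
    exact Set.mul_mem_mul (Set.mul_mem_mul ⟨_, rfl⟩ ⟨x, hx, rfl⟩) ⟨_, rfl⟩
  rcases hE with hE | ⟨p, hp, hE⟩
  · let T : Finset (E × E) := ha.toFinset ×ˢ hb.toFinset
    refine ⟨T.card • insert 0 D, finite_nsmul (hD.insert 0) _, fun m => ?_⟩
    obtain ⟨k, u, v, hu0, huk, hvk, huv⟩ := key m
    have hseg : ∀ i d, i + d ≤ k → ∃ s, u (i + d) = u i * s ∧ v i = s * v (i + d) := by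
      intro i d
      induction d with
      | zero => exact fun _ => ⟨1, by simp⟩
      | succ d ih =>
        intro hd
        obtain ⟨s, h1, h2⟩ := ih (by omega)
        obtain ⟨x, -, h3, h4⟩ := huv (i + d) (by omega)
        exact ⟨s * x, by rw [← add_assoc, h3, h1, mul_assoc],
          by rw [h2, h4, mul_assoc, add_assoc]⟩
    have := mem_card_nsmul_of_steps D (fun i => (ρ (u i) * P, (1 - P) * ρ (v i)))
      (fun i => P * ρ (u i) * (1 - P) * ρ (v i)) k (by simp only [hu0, hF0]) (hstep k u v huv) (by
        intro i j hij hj hc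
        obtain ⟨d, rfl⟩ := Nat.exists_eq_add_of_le hij
        obtain ⟨s, h1, h2⟩ := hseg i d hj
        simp only [Prod.mk.injEq] at hc
        have hpow := mul_map_pow_mul_eq_nsmul hP hρ (u := u i) (s := s) (v := v (i + d))
          (by rw [← h1, hc.1]) (by rw [← h2, hc.2])
        obtain ⟨n, n', hn, hs⟩ := hM s
        have hz : ρ (u i) * P * ρ s * ((1 - P) * ρ (v (i + d))) = 0 := by
          have h3 := hpow n
          rw [hs, hpow n'] at h3
          obtain ⟨r, rfl⟩ := Nat.exists_eq_add_of_lt hn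
          rw [add_assoc, add_nsmul, add_eq_left] at h3
          exact IsAddTorsionFree.nsmul_right_injective (Nat.succ_ne_zero r)
            (by simpa using h3)
        rw [← peirce_difference hρ, ← h1, ← h2, sub_eq_zero] at hz
        exact hz.symm) k le_rfl
    simp only [huk, hvk, map_one, mul_one] at this
    refine Set.nsmul_subset_nsmul_right (Set.mem_insert 0 D) (Finset.card_le_card ?_) this
    intro c hc
    obtain ⟨i, -, rfl⟩ := Finset.mem_image.1 hc
    exact Finset.mem_product.2 ⟨ha.mem_toFinset.2 ⟨_, rfl⟩, hb.mem_toFinset.2 ⟨_, rfl⟩⟩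
  · refine ⟨_, finite_closure_of_nsmul_eq_zero hp hE hD, fun m => ?_⟩
    obtain ⟨k, u, v, hu0, huk, hvk, huv⟩ := key m
    have : ∀ i ≤ k, P * ρ (u i) * (1 - P) * ρ (v i) ∈ AddSubgroup.closure D := by
      intro i
      induction i with
      | zero => intro _; rw [hu0, hF0]; exact zero_mem _
      | succ i ih =>
        intro hi
        have := add_mem (AddSubgroup.subset_closure (hstep k u v huv i hi)) (ih (by omega))
        rwa [sub_add_cancel] at this
    simpa [huk, hvk] using this k le_rfl

end Peirce

theorem finite_quotient_of_isMaximal {A : Type*} [CommRing A] [Algebra.FiniteType ℤ A]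
    (m : Ideal A) [m.IsMaximal] : Finite (A ⧸ m) := by
  let : Field (A ⧸ m) := Ideal.Quotient.field m
  have : Algebra.FiniteType ℤ (A ⧸ m) :=
    .of_surjective (Ideal.Quotient.mkₐ ℤ m) Ideal.Quotient.mk_surjective
  exact finite_of_finiteType_int (A ⧸ m)

open Polynomial in
theorem exists_prime_pow_bound {K ι : Type*} [Field K] [Fintype ι] [DecidableEq ι]
    {Y : Set K} (hY : Y.Finite) :
    ∃ p N : ℕ, p.Prime ∧ 0 < N ∧ ((p : K) = 0 ∨ (p : K)⁻¹ ∉ Y) ∧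
      ∀ s : Matrix ι ι K, (∀ i j, s i j ∈ Algebra.adjoin ℤ Y) →
        ∀ z, s.charpoly.IsRoot z → ∀ k, 0 < k → z ^ k = 1 → ∃ e, z ^ (N * p ^ e) = 1 := by
  let R := Algebra.adjoin ℤ Y
  have : Algebra.FiniteType ℤ R := .adjoin_of_finite hY
  obtain ⟨m, hm⟩ := Ideal.exists_maximal R
  let C := integralClosure R K
  have hRC : Function.Injective (algebraMap R C) := fun x y h =>
    Subtype.ext (congrArg (algebraMap C K) h)
  have : FaithfulSMul R C := (faithfulSMul_iff_algebraMap_injective R C).2 hRC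
  obtain ⟨Q, hQ, hQm⟩ := Ideal.exists_maximal_ideal_liesOver_of_isIntegral (S := C) m
  let : Field (R ⧸ m) := Ideal.Quotient.field m
  let : Field (C ⧸ Q) := Ideal.Quotient.field Q
  have : Finite (R ⧸ m) := finite_quotient_of_isMaximal m
  obtain ⟨p, hp⟩ := CharP.exists (R ⧸ m)
  have hpp : p.Prime := (CharP.char_is_prime_or_zero (R ⧸ m) p).resolve_right
    (CharP.char_ne_zero_of_finite (R ⧸ m) p)
  have : CharP (C ⧸ Q) p := charP_of_injective_algebraMap (algebraMap (R ⧸ m) (C ⧸ Q)).injective p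
  obtain ⟨i, N, hN, hiN⟩ := exists_pow_add_eq_pow (Matrix ι ι (R ⧸ m))
  refine ⟨p, N, hpp, hN, ?_, ?_⟩
  · by_contra! h
    obtain ⟨r, hr⟩ : ∃ r : R, (r : K) = (p : K)⁻¹ := ⟨⟨_, Algebra.subset_adjoin h.2⟩, rfl⟩
    have h1 : r * (p : R) = 1 := Subtype.ext (by simp [hr, h.1])
    have h2 := congrArg (Ideal.Quotient.mk m) h1
    rw [map_mul, map_natCast, CharP.cast_eq_zero, mul_zero, map_one] at h2
    exact zero_ne_one h2
  · intro s hs z hz k hk hzk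
    let t : Matrix ι ι R := fun i j => ⟨s i j, hs i j⟩
    let w : C := ⟨z, .of_pow hk (by rw [hzk]; exact isIntegral_one)⟩
    have hw : w ^ k = 1 := Subtype.ext hzk
    have hroot : (t.map (algebraMap R C)).charpoly.IsRoot w := by
      apply IsRoot.of_map (f := algebraMap C K) _ (FaithfulSMul.algebraMap_injective C K)
      rw [← Matrix.charpoly_map]
      exact hz
    have hroot' := hroot.map (f := Ideal.Quotient.mk Q)
    rw [← Matrix.charpoly_map] at hroot'
    have hspec := Matrix.mem_spectrum_of_isRoot_charpoly hroot'
    set B := (t.map (algebraMap R C)).map (Ideal.Quotient.mk Q) with hB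
    have hBpow : B ^ (i + N) = B ^ i := by
      have : B = (algebraMap (R ⧸ m) (C ⧸ Q)).mapMatrix (t.map (Ideal.Quotient.mk m)) := rfl
      rw [this, ← map_pow, hiN, map_pow]
    have h3 := spectrum.subset_polynomial_aeval B (X ^ (i + N) - X ^ i : (C ⧸ Q)[X])
      ⟨_, hspec, rfl⟩
    have hnt : Nontrivial (Matrix ι ι (C ⧸ Q)) := by
      by_contra h
      rw [not_nontrivial_iff_subsingleton] at h
      simp at hspec
    simp only [map_sub, map_pow, aeval_X, hBpow, sub_self, spectrum.zero_eq, eval_sub, eval_pow,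
      eval_X, Set.mem_singleton_iff] at h3
    have hw0 : Ideal.Quotient.mk Q w ≠ 0 := fun h => by
      have := congrArg (Ideal.Quotient.mk Q) hw
      rw [map_pow, h, zero_pow hk.ne', map_one] at this
      exact zero_ne_one this
    rw [pow_add, sub_eq_zero, mul_eq_left₀ (pow_ne_zero _ hw0), ← map_pow] at h3
    obtain ⟨e, he⟩ := exists_pow_prime_pow_eq_one (Ideal.Quotient.mk Q) p hpp h3 hk
      (by rw [← pow_mul, mul_comm, pow_mul, hw, one_pow])
    refine ⟨e, ?_⟩
    rw [pow_mul]
    exact congrArg Subtype.val he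

/-- The roots of unity among the eigenvalues of matrices of a fixed size over a finitely generated
subring of a field have bounded order. -/
theorem exists_pow_eq_one_bound {K ι : Type*} [Field K] [Fintype ι] [DecidableEq ι]
    {Y : Set K} (hY : Y.Finite) :
    ∃ N : ℕ, 0 < N ∧
      ∀ s : Matrix ι ι K, (∀ i j, s i j ∈ Algebra.adjoin ℤ Y) →
        ∀ z, s.charpoly.IsRoot z → ∀ k, 0 < k → z ^ k = 1 → z ^ N = 1 := by
  have hchar : ∀ (p : ℕ), p.Prime → (p : K) = 0 → ∀ (z : K) (N e : ℕ), z ^ (N * p ^ e) = 1 →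
      z ^ N = 1 := by
    intro p hp hp0 z N e h
    have : Fact p.Prime := ⟨hp⟩
    have : CharP K p := (CharP.charP_iff_prime_eq_zero hp).2 hp0
    rw [pow_mul] at h
    exact iterateFrobenius_inj K p e (by simpa [iterateFrobenius_def] using h)
  obtain ⟨p, N, hp, hN, -, h⟩ := exists_prime_pow_bound (ι := ι) hY
  obtain ⟨q, N', hq, hN', hqp, h'⟩ := exists_prime_pow_bound (ι := ι) (hY.insert (p : K)⁻¹)
  refine ⟨N * N', Nat.mul_pos hN hN', fun s hs z hz k hk hzk => ?_⟩
  obtain ⟨e, he⟩ := h s hs z hz k hk hzk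
  obtain ⟨e', he'⟩ := h' s (fun i j => Algebra.adjoin_mono (Set.subset_insert _ _) (hs i j))
    z hz k hk hzk
  rcases hqp with hq0 | hqY
  · rw [mul_comm, pow_mul, hchar q hq hq0 z N' e' he', one_pow]
  · have hne : p ≠ q := by
      rintro rfl
      exact hqY (Set.mem_insert _ _)
    have h1 : orderOf z ∣ N * N' * p ^ e :=
      (orderOf_dvd_of_pow_eq_one he).trans ⟨N', by ring⟩
    have h2 : orderOf z ∣ N * N' * q ^ e' :=
      (orderOf_dvd_of_pow_eq_one he').trans ⟨N, by ring⟩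
    have h3 := Nat.dvd_gcd h1 h2
    rw [Nat.gcd_mul_left, Nat.Coprime.gcd_eq_one (Nat.coprime_pow_primes _ _ hp hq hne),
      mul_one] at h3
    exact orderOf_dvd_iff_pow_eq_one.1 h3

section Periodic

variable {M : Type*} [Monoid M]

theorem finite_sums_of_card_eq {A : Type*} [AddCommMonoid A] {Z : Set A} (hZ : Z.Finite) (n : ℕ) :
    {a : A | ∃ t : Multiset A, t.card = n ∧ (∀ z ∈ t, z ∈ Z) ∧ t.sum = a}.Finite := by
  induction n with
  | zero =>
    refine (Set.finite_singleton 0).subset ?_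
    rintro a ⟨t, ht, -, rfl⟩
    simp [Multiset.card_eq_zero.1 ht]
  | succ n ih =>
    refine (Set.Finite.image2 (· + ·) hZ ih).subset ?_
    rintro a ⟨t, ht, htZ, rfl⟩
    obtain ⟨z, hz⟩ := Multiset.card_pos_iff_exists_mem.1 (by omega : 0 < t.card)
    obtain ⟨t, rfl⟩ := Multiset.exists_cons_of_mem hz
    rw [Multiset.card_cons, Nat.add_right_cancel_iff] at ht
    exact ⟨z, htZ z (Multiset.mem_cons_self z t), t.sum,
      ⟨t, ht, fun y hy => htZ y (Multiset.mem_cons_of_mem hy), rfl⟩, (Multiset.sum_cons z t).symm⟩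

open Polynomial in
theorem finite_range_trace_matrix {K ι : Type*} [Field K] [IsAlgClosed K] [Fintype ι]
    [DecidableEq ι] [Monoid.FG M] (hM : ∀ m : M, ∃ i j : ℕ, i < j ∧ m ^ i = m ^ j)
    (ρ : M →* Matrix ι ι K) : (Set.range fun m => (ρ m).trace).Finite := by
  obtain ⟨G, hG⟩ := Monoid.FG.fg_top (M := M)
  let Y : Set K := ⋃ x ∈ G, Set.range fun ij : ι × ι => ρ x ij.1 ij.2
  have hY : Y.Finite := G.finite_toSet.biUnion fun x _ => Set.finite_range _
  have hmem : ∀ m i j, ρ m i j ∈ Algebra.adjoin ℤ Y := by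
    intro m
    induction hG ▸ Submonoid.mem_top m using Submonoid.closure_induction with
    | mem x hx =>
      exact fun i j => Algebra.subset_adjoin (Set.mem_biUnion hx ⟨(i, j), rfl⟩)
    | one =>
      intro i j
      rw [map_one, Matrix.one_apply]
      split_ifs
      exacts [one_mem _, zero_mem _]
    | mul x y _ _ hx hy =>
      intro i j
      rw [map_mul, Matrix.mul_apply]
      exact sum_mem fun l _ => mul_mem (hx i l) (hy l j)
  classical
  obtain ⟨N, hN, h⟩ := exists_pow_eq_one_bound (ι := ι) hY
  let Z : Set K := insert 0 {z | z ^ N = 1}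
  have hZ : Z.Finite := by
    refine Set.Finite.insert 0 (((nthRoots N (1 : K)).toFinset.finite_toSet).subset ?_)
    intro z hz
    simpa [mem_nthRoots hN] using hz
  refine (finite_sums_of_card_eq hZ (Fintype.card ι)).subset ?_
  rintro _ ⟨m, rfl⟩
  refine ⟨(ρ m).charpoly.roots, ?_, fun z hz => ?_, (Matrix.trace_eq_sum_roots_charpoly _).symm⟩
  · rw [← (IsAlgClosed.splits (ρ m).charpoly).natDegree_eq_card_roots,
      Matrix.charpoly_natDegree_eq_dim]
  · by_cases hz0 : z = 0
    · exact Or.inl hz0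
    · right
      have hroot := isRoot_of_mem_roots hz
      obtain ⟨i, j, hij, hm⟩ := hM m
      have h3 := spectrum.subset_polynomial_aeval (ρ m) (X ^ j - X ^ i : K[X])
        ⟨_, Matrix.mem_spectrum_of_isRoot_charpoly hroot, rfl⟩
      have hnt : Nontrivial (Matrix ι ι K) := by
        by_contra hn
        rw [not_nontrivial_iff_subsingleton] at hn
        have := Matrix.mem_spectrum_of_isRoot_charpoly hroot
        simp at this
      rw [map_sub, map_pow, map_pow, aeval_X, ← map_pow, ← map_pow, hm, sub_self,
        spectrum.zero_eq] at h3
      simp only [eval_sub, eval_pow, eval_X, Set.mem_singleton_iff] at h3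
      obtain ⟨k, rfl⟩ := Nat.exists_eq_add_of_lt hij
      rw [add_assoc, pow_add, sub_eq_zero, mul_eq_left₀ (pow_ne_zero _ hz0)] at h3
      exact h (ρ m) (hmem m) z hroot _ (Nat.succ_pos k) h3

variable {K V : Type*} [Field K] [IsAlgClosed K] [AddCommGroup V] [Module K V]
  [FiniteDimensional K V] [Monoid.FG M]

theorem finite_range_trace (hM : ∀ m : M, ∃ i j : ℕ, i < j ∧ m ^ i = m ^ j)
    (ρ : Representation K M V) : (Set.range fun m => LinearMap.trace K V (ρ m)).Finite := by
  classical
  let b := Module.finBasis K V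
  refine (finite_range_trace_matrix hM
    ((LinearMap.toMatrixAlgEquiv b).toMulEquiv.toMonoidHom.comp ρ)).subset ?_
  rintro _ ⟨m, rfl⟩
  exact ⟨m, (LinearMap.trace_eq_matrix_trace K b (ρ m)).symm⟩

/-- **Burnside's theorem** on irreducible matrix monoids. -/
theorem Representation.span_range_eq_top_of_isIrreducible {M : Type*} [Monoid M]
    (ρ : Representation K M V) [ρ.IsIrreducible] : Submodule.span K (Set.range ρ) = ⊤ := by
  have : IsSimpleModule (MonoidAlgebra K M) ρ.asModule :=
    (Representation.irreducible_iff_isSimpleModule_asModule ρ).1 inferInstance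
  have hbij := IsSimpleModule.algebraMap_end_bijective_of_isAlgClosed (A := MonoidAlgebra K M)
    (V := ρ.asModule) K
  rw [eq_top_iff]
  intro f _
  let g : Module.End (Module.End (MonoidAlgebra K M) ρ.asModule) ρ.asModule :=
    { toFun := fun v => f v
      map_add' := fun v w => f.map_add v w
      map_smul' := fun c v => by
        obtain ⟨r, rfl⟩ := hbij.2 c
        exact f.map_smul r v }
  have b := Module.finBasis K V
  obtain ⟨r, hr⟩ := jacobson_density g (Set.finite_range b).toFinset
  have hf : f = ρ.asAlgebraHom r := b.ext fun i =>
    hr (b i) ((Set.finite_range b).mem_toFinset.2 ⟨i, rfl⟩)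
  rw [hf]
  clear hf hr
  induction r using MonoidAlgebra.induction_linear with
  | zero => simp
  | add x y hx hy => rw [map_add]; exact add_mem hx hy
  | single g k =>
    rw [Representation.asAlgebraHom_single]
    exact Submodule.smul_mem _ _ (Submodule.subset_span ⟨g, rfl⟩)

theorem eq_of_trace_mul_eq {K V : Type*} [Field K] [AddCommGroup V] [Module K V]
    [FiniteDimensional K V] {f g : Module.End K V}
    (h : ∀ x : Module.End K V, LinearMap.trace K V (f * x) = LinearMap.trace K V (g * x)) :
    f = g := by
  ext v
  rw [← sub_eq_zero, ← Module.forall_dual_apply_eq_zero_iff K]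
  intro φ
  have h' := h (φ.smulRight v)
  have hsmul : ∀ f : Module.End K V, f * φ.smulRight v = φ.smulRight (f v) := fun f => by
    ext; simp
  simpa [hsmul, sub_eq_zero] using h'

theorem finite_range_of_isIrreducible (hM : ∀ m : M, ∃ i j : ℕ, i < j ∧ m ^ i = m ^ j)
    (ρ : Representation K M V) [ρ.IsIrreducible] : (Set.range ρ).Finite := by
  obtain ⟨s, hs, hsp, hli⟩ := exists_linearIndependent K (Set.range ρ)
  have hsfin : Finite s := hli.setFinite
  rw [ρ.span_range_eq_top_of_isIrreducible] at hsp
  let T : Module.End K V → (s → K) := fun f t => LinearMap.trace K V (f * t)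
  have hT : Function.Injective T := by
    intro f g hfg
    have : (LinearMap.trace K V).comp (LinearMap.mulLeft K f) =
        (LinearMap.trace K V).comp (LinearMap.mulLeft K g) :=
      LinearMap.ext_on hsp fun t ht => congrFun hfg ⟨t, ht⟩
    exact eq_of_trace_mul_eq fun h => LinearMap.congr_fun this h
  refine Set.Finite.of_finite_image (f := T) (Set.Finite.subset (Set.Finite.pi' (ι := s)
    fun _ => finite_range_trace hM ρ) ?_) hT.injOn
  rintro _ ⟨_, ⟨m, rfl⟩, rfl⟩ ⟨t, ht⟩
  obtain ⟨n, rfl⟩ := hs ht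
  exact ⟨m * n, by simp [T]⟩

end Periodic

section Reducible

theorem isAddTorsionFree_or_exists_nsmul_eq_zero (K E : Type*) [Field K] [AddCommGroup E]
    [Module K E] : IsAddTorsionFree E ∨ ∃ p : ℕ, 0 < p ∧ ∀ x : E, p • x = 0 := by
  obtain ⟨p, hp⟩ := CharP.exists K
  rcases Nat.eq_zero_or_pos p with rfl | hpos
  · left
    have : CharZero K := CharP.charP_to_charZero K
    refine ⟨fun n hn x y hxy => ?_⟩
    simp only [← Nat.cast_smul_eq_nsmul K] at hxy
    exact smul_right_injective E (Nat.cast_ne_zero.2 hn : (n : K) ≠ 0) hxy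
  · exact Or.inr ⟨p, hpos, fun x => by
      rw [← Nat.cast_smul_eq_nsmul K, CharP.cast_eq_zero, zero_smul]⟩

variable {M K V : Type*} [Monoid M] [Monoid.FG M] [Field K] [AddCommGroup V] [Module K V]

theorem Representation.finite_range_of_finite_range_quotient
    (hM : ∀ m : M, ∃ i j : ℕ, i < j ∧ m ^ i = m ^ j) (ρ : Representation K M V)
    (W : Submodule K V) (hW : ∀ m, W ≤ W.comap (ρ m))
    (hsub : (Set.range (ρ.subrepresentation W hW)).Finite)
    (hquo : (Set.range (ρ.quotient W hW)).Finite) : (Set.range ρ).Finite := by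
  obtain ⟨U, hU⟩ := W.exists_isCompl
  let P : Module.End K V := W.projection U hU
  have hPmem : ∀ v, P v ∈ W := Submodule.projection_apply_mem hU
  have hPW : ∀ v ∈ W, P v = v := fun v hv => Submodule.projection_apply_of_mem_left hU hv
  refine finite_range_of_peirce (P := P) hM (isAddTorsionFree_or_exists_nsmul_eq_zero K _)
    ?_ ?_ ?_ ?_
  · ext v
    exact hPW _ (hPmem v)
  · intro m
    ext v
    simp [hPW _ (hW m (hPmem v))]
  · refine (hsub.image fun f =>
      (W.subtype ∘ₗ f ∘ₗ W.projectionOnto U hU : Module.End K V)).subset ?_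
    rintro _ ⟨m, rfl⟩
    exact ⟨_, ⟨m, rfl⟩, rfl⟩
  · have hker : W ≤ LinearMap.ker (1 - P : Module.End K V) := fun v hv => by simp [hPW v hv]
    refine (hquo.image fun f => (W.liftQ (1 - P) hker ∘ₗ f ∘ₗ W.mkQ : Module.End K V)).subset ?_
    rintro _ ⟨m, rfl⟩
    exact ⟨_, ⟨m, rfl⟩, rfl⟩

end Reducible

theorem Representation.finite_range_of_periodic {M K : Type*} [Monoid M] [Monoid.FG M] [Field K]
    [IsAlgClosed K] (hM : ∀ m : M, ∃ i j : ℕ, i < j ∧ m ^ i = m ^ j) (n : ℕ) :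
    ∀ (V : Type*) [AddCommGroup V] [Module K V] [FiniteDimensional K V],
      Module.finrank K V = n → ∀ ρ : Representation K M V, (Set.range ρ).Finite := by
  induction n using Nat.strong_induction_on with
  | _ n ih =>
    intro V _ _ _ hn ρ
    rcases subsingleton_or_nontrivial V with hV | hV
    · exact Set.toFinite _
    by_cases hirr : ∀ W : Submodule K V, (∀ m, W ≤ W.comap (ρ m)) → W = ⊥ ∨ W = ⊤
    · have : ρ.IsIrreducible :=
        { exists_pair_ne := ⟨⊥, ⊤, fun h => bot_ne_top (α := Submodule K V)
            (congrArg Subrepresentation.toSubmodule h)⟩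
          eq_bot_or_eq_top := fun W =>
            (hirr W.toSubmodule fun m _ hv => W.apply_mem_toSubmodule m hv).imp
              (fun h => Subrepresentation.toSubmodule_injective h)
              (fun h => Subrepresentation.toSubmodule_injective h) }
      exact finite_range_of_isIrreducible hM ρ
    · push Not at hirr
      obtain ⟨W, hW, hbot, htop⟩ := hirr
      have h1 : Module.finrank K W < n := hn ▸ Submodule.finrank_lt htop
      have h2 : Module.finrank K (V ⧸ W) < n := by
        have := W.finrank_quotient_add_finrank
        have := Submodule.one_le_finrank_iff.2 hbot
        omega
      exact ρ.finite_range_of_finite_range_quotient hM W hW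
        (ih _ h1 W rfl _) (ih _ h2 (V ⧸ W) rfl _)

theorem exists_pow_eq_pow_of_finite_closure {M : Type*} [Monoid M] {s : M}
    (hs : (Subsemigroup.closure {s} : Set M).Finite) : ∃ i j : ℕ, i < j ∧ s ^ i = s ^ j := by
  have hmem : ∀ n : ℕ, s ^ (n + 1) ∈ Subsemigroup.closure {s} := by
    intro n
    induction n with
    | zero => simpa using Subsemigroup.subset_closure (Set.mem_singleton s)
    | succ n ih => exact pow_succ s (n + 1) ▸ mul_mem ih (Subsemigroup.subset_closure rfl)
  obtain ⟨i, -, j, -, hij, h⟩ := Set.infinite_univ.exists_lt_map_eq_of_mapsTo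
    (f := fun n : ℕ => s ^ (n + 1)) (fun n _ => hmem n) hs
  exact ⟨i + 1, j + 1, by omega, h⟩

/-- **Theorem (McNaughton–Zalcstein).** A finitely generated periodic subsemigroup of the
multiplicative semigroup of `n × n` matrices over a field is finite. -/
theorem periodic_fg_matrix_subsemigroup_finite
    {K : Type*} [Field K] {n : ℕ}
    (S : Subsemigroup (Matrix (Fin n) (Fin n) K))
    (hfg : ∃ X : Set (Matrix (Fin n) (Fin n) K), X.Finite ∧ Subsemigroup.closure X = S)
    (hper : ∀ s ∈ S, (Subsemigroup.closure {s} : Set (Matrix (Fin n) (Fin n) K)).Finite) :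
    (S : Set (Matrix (Fin n) (Fin n) K)).Finite := by
  obtain ⟨X, hX, rfl⟩ := hfg
  let M := Submonoid.closure X
  have : Monoid.FG M := (Monoid.fg_iff_submonoid_fg M).2 ((Submonoid.fg_iff M).2 ⟨X, rfl, hX⟩)
  have hM : ∀ m : M, ∃ i j : ℕ, i < j ∧ m ^ i = m ^ j := by
    rintro ⟨m, hm⟩
    have hmS : m = 1 ∨ m ∈ Subsemigroup.closure X := by
      induction hm using Submonoid.closure_induction with
      | mem x hx => exact Or.inr (Subsemigroup.subset_closure hx)
      | one => exact Or.inl rfl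
      | mul x y _ _ hx hy =>
        rcases hx with rfl | hx
        · simpa using hy
        · rcases hy with rfl | hy
          · exact Or.inr (by simpa using hx)
          · exact Or.inr (mul_mem hx hy)
    have : ∃ i j : ℕ, i < j ∧ m ^ i = m ^ j := by
      rcases hmS with rfl | h
      · exact ⟨0, 1, zero_lt_one, by simp⟩
      · exact exists_pow_eq_pow_of_finite_closure (hper m h)
    obtain ⟨i, j, hij, h⟩ := this
    exact ⟨i, j, hij, Subtype.ext h⟩
  let L := AlgebraicClosure K
  let φ : Matrix (Fin n) (Fin n) K →* Module.End L (Fin n → L) :=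
    (Matrix.toLinAlgEquiv' (R := L) (n := Fin n)).toMulEquiv.toMonoidHom.comp
      (algebraMap K L).mapMatrix.toMonoidHom
  have hφ : Function.Injective φ :=
    (Matrix.toLinAlgEquiv' (R := L) (n := Fin n)).injective.comp
      (Matrix.map_injective (algebraMap K L).injective)
  have hfin := Representation.finite_range_of_periodic hM _ _ rfl (φ.comp M.subtype)
  have hMfin : (M : Set (Matrix (Fin n) (Fin n) K)).Finite := by
    refine Set.Finite.of_finite_image (f := φ) (hfin.subset ?_) hφ.injOn
    rintro _ ⟨m, hm, rfl⟩
    exact ⟨⟨m, hm⟩, rfl⟩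
  refine hMfin.subset ?_
  exact (Subsemigroup.closure_le (S := M.toSubsemigroup)).2 Submonoid.subset_closure
end

section
/- Let K be a field and let G be a finitely generated subgroup of the general linear group GL_n(K) in which every element has finite order. Then G is finite (Schur's theorem). -/
open Matrix

theorem Int.isJacobsonRing : IsJacobsonRing ℤ := by
  rw [isJacobsonRing_iff_prime_eq]
  intro P hP
  by_cases hbot : P = ⊥
  · subst hbot
    rw [eq_bot_iff]
    intro x hx
    rw [Ideal.mem_jacobson_bot] at hx
    have h := hx (3 * x)
    rw [Int.isUnit_iff] at h
    rw [Ideal.mem_bot]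
    by_contra hne
    have : 0 < x ^ 2 := by positivity
    rcases h with h | h <;> nlinarith
  · have := hP.isMaximal hbot
    exact Ideal.jacobson_eq_self_of_isMaximal

/-- A residue field of a finitely generated ring is finite. -/
theorem Field.finite_of_surjective_of_finiteType_int {R F : Type*} [CommRing R]
    [Algebra.FiniteType ℤ R] [Field F] (f : R →+* F) (hf : Function.Surjective f) :
    Finite F := by
  have : Algebra.FiniteType ℤ F := .of_surjective f.toIntAlgHom hf
  have := Int.isJacobsonRing
  have hfin : Module.Finite ℤ F := finite_of_finite_type_of_isJacobsonRing ℤ F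
  obtain ⟨p, hp⟩ := CharP.exists F
  have hp0 : p ≠ 0 := by
    rintro rfl
    have : CharZero F := CharP.charP_to_charZero F
    exact Int.not_isField
      (isField_of_isIntegral_of_isField (algebraMap ℤ F).injective_int (Field.toIsField F))
  refine Module.finite_of_fg_torsion F fun {x} => ?_
  refine ⟨⟨(p : ℤ), mem_nonZeroDivisors_of_ne_zero (by exact_mod_cast hp0)⟩, ?_⟩
  simp [Submonoid.smul_def]

/-- A linear `p`-group over a finite field of characteristic `p` fixes a nonzero vector. -/
theorem IsPGroup.exists_ne_zero_fixed {p : ℕ} [Fact p.Prime] {P F V : Type*} [Group P]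
    (hP : IsPGroup p P) [Field F] [CharP F p] [AddCommGroup V] [Module F V] [Finite V]
    [Nontrivial V] (ρ : Representation F P V) : ∃ v ≠ 0, ∀ g, ρ g v = v := by
  let _ : MulAction P V :=
    { smul := fun g v => ρ g v
      one_smul := fun v => by change ρ 1 v = v; simp
      mul_smul := fun g h v => by change ρ (g * h) v = ρ g (ρ h v); simp }
  obtain ⟨v, hv⟩ := exists_ne (0 : V)
  have hpv : p • v = 0 := by
    rw [← Nat.cast_smul_eq_nsmul F, CharP.cast_eq_zero, zero_smul]
  have hdvd : p ∣ Nat.card V := by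
    rw [← addOrderOf_eq_prime hpv hv]
    exact addOrderOf_dvd_natCard v
  have h0 : (0 : V) ∈ MulAction.fixedPoints P V := fun g => map_zero (ρ g)
  obtain ⟨b, hb, hne⟩ := hP.exists_fixed_point_of_prime_dvd_card_of_fixed_point V hdvd h0
  exact ⟨b, hne.symm, hb⟩

theorem Representation.mkQ_prod_sub_one {P F V : Type*} [Group P] [Field F] [AddCommGroup V]
    [Module F V] (ρ : Representation F P V) (W : Submodule F V) (hW : ∀ g, W ≤ W.comap (ρ g))
    (l : List P) (v : V) :
    W.mkQ ((l.map fun g => ρ g - 1).prod v) =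
      (l.map fun g => ρ.quotient W hW g - 1).prod (W.mkQ v) := by
  induction l with
  | nil => simp
  | cons g t ih =>
    simp only [List.map_cons, List.prod_cons, Module.End.mul_apply, ← ih]
    simp

/-- The augmentation ideal of a linear `p`-group in characteristic `p` is nilpotent. -/
theorem IsPGroup.prod_sub_one_eq_zero {p : ℕ} [Fact p.Prime] {P F : Type*} [Group P]
    (hP : IsPGroup p P) [Field F] [Finite F] [CharP F p] (k : ℕ) :
    ∀ {V : Type*} [AddCommGroup V] [Module F V] [Module.Finite F V] (ρ : Representation F P V),
      Module.finrank F V ≤ k → ∀ l : List P, l.length = k →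
        (l.map fun g => ρ g - 1).prod = 0 := by
  induction k with
  | zero =>
    intro V _ _ _ ρ hk l _
    have : Subsingleton V := Module.finrank_zero_iff.mp (Nat.le_zero.mp hk)
    exact Subsingleton.elim _ _
  | succ k ih =>
    intro V _ _ _ ρ hk l hl
    rcases subsingleton_or_nontrivial V with _ | _
    · exact Subsingleton.elim _ _
    obtain ⟨g, t, rfl⟩ := List.exists_cons_of_length_eq_add_one hl
    have : Finite V := Module.finite_of_finite F
    obtain ⟨w, hw0, hw⟩ := hP.exists_ne_zero_fixed ρ
    have hW : ∀ g, ρ.invariants ≤ ρ.invariants.comap (ρ g) := fun g v hv => by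
      rw [Submodule.mem_comap, hv g]
      exact hv
    have hne : ρ.invariants ≠ ⊥ := fun h => hw0 ((Submodule.mem_bot F).mp (h ▸ hw))
    have hpos : 0 < Module.finrank F ρ.invariants := by
      rwa [Nat.pos_iff_ne_zero, ne_eq, Submodule.finrank_eq_zero]
    have hadd := ρ.invariants.finrank_quotient_add_finrank
    have hquot := ih (ρ.quotient ρ.invariants hW) (by omega) t (by simpa using hl)
    ext v
    have hv : (t.map fun g => ρ g - 1).prod v ∈ ρ.invariants := by
      rw [← Submodule.Quotient.mk_eq_zero, ← Submodule.mkQ_apply,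
        ρ.mkQ_prod_sub_one ρ.invariants hW, hquot, LinearMap.zero_apply]
    simp [hv g]

/-- In positive characteristic, a finitely generated group of units whose augmentation ideal is
nilpotent is finite. -/
theorem Group.FG.finite_range_of_prod_sub_one_eq_zero {N A : Type*} [Group N] [Group.FG N] [Ring A]
    {p : ℕ} (hp : p ≠ 0) [CharP A p] (φ : N →* A) (k : ℕ)
    (hφ : ∀ l : List N, l.length = k → (l.map fun g => φ g - 1).prod = 0) :
    (Set.range φ).Finite := by
  obtain ⟨T, hT⟩ := Monoid.fg_def.mp (Group.fg_iff_monoid_fg.mp ‹Group.FG N›)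
  let word : List T → A := fun l => (l.map fun g : T => φ g - 1).prod
  have hword : ∀ l : List T, l.length = k → word l = 0 := fun l hl => by
    have := hφ (l.map (↑)) (by simpa using hl)
    rwa [List.map_map] at this
  have hfin : (word '' {l | l.length < k + 1}).Finite := (List.finite_length_lt T (k + 1)).image _
  let B : AddSubgroup A := AddSubgroup.closure (word '' {l | l.length < k + 1})
  have hBfg : AddGroup.FG B :=
    (AddGroup.fg_iff_addSubgroup_fg B).mpr ((AddSubgroup.fg_iff B).mpr ⟨_, rfl, hfin⟩)
  have htors : IsAddTorsion B := fun x => by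
    rw [isOfFinAddOrder_iff_nsmul_eq_zero]
    refine ⟨p, Nat.pos_of_ne_zero hp, Subtype.ext ?_⟩
    simp [nsmul_eq_mul]
  have hBfin : Finite B := AddCommGroup.finite_of_fg_isAddTorsion B htors
  have hmul : ∀ t : T, ∀ b ∈ B, φ t * b ∈ B := fun t b hb => by
    induction hb using AddSubgroup.closure_induction with
    | mem x hx =>
      obtain ⟨l, hl, rfl⟩ := hx
      have hstep : φ t * word l = word l + word (t :: l) := by simp [word, sub_mul]
      rw [hstep]
      refine B.add_mem (AddSubgroup.subset_closure ⟨l, hl, rfl⟩) ?_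
      rcases Nat.lt_succ_iff_lt_or_eq.mp hl with hlt | heq
      · exact AddSubgroup.subset_closure ⟨t :: l, by simpa using hlt, rfl⟩
      · have : word (t :: l) = 0 := by
          change (φ t - 1) * word l = 0
          rw [hword l heq, mul_zero]
        rw [this]
        exact B.zero_mem
    | zero => simp
    | add x y _ _ hx hy => rw [mul_add]; exact B.add_mem hx hy
    | neg x _ hx => rw [mul_neg]; exact B.neg_mem hx
  refine (Set.toFinite (B : Set A)).subset ?_
  rintro _ ⟨x, rfl⟩
  have hx : x ∈ Submonoid.closure (T : Set N) := hT ▸ Submonoid.mem_top x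
  induction hx using Submonoid.closure_induction_left with
  | one => exact AddSubgroup.subset_closure ⟨[], by simp, by simp [word]⟩
  | mul_left t ht y _ hy => rw [map_mul]; exact hmul ⟨t, ht⟩ _ hy

/-- A matrix of finite order that is trivial modulo the kernel of `f` is trivial when `f` does not
kill some exponent of it. -/
theorem Matrix.eq_one_of_pow_eq_one_of_map_eq_one {R F : Type*} [CommRing R] [IsDomain R] [Field F]
    {n : ℕ} (f : R →+* F) (g : Matrix (Fin n) (Fin n) R) {a : ℕ} (ha : (a : F) ≠ 0)
    (hg : g ^ a = 1) (hfg : f.mapMatrix g = 1) : g = 1 := by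
  set s := ∑ i ∈ Finset.range a, g ^ i
  have hs : f.mapMatrix s = (a : F) • (1 : Matrix (Fin n) (Fin n) F) := by
    simp [s, map_sum, map_pow, hfg, Nat.cast_smul_eq_nsmul]
  have hdet : s.det ≠ 0 := fun h => by
    have := f.map_det s
    rw [h, map_zero, hs, det_smul, det_one, mul_one] at this
    exact pow_ne_zero _ ha this.symm
  have hmul : s * (g - 1) = 0 := by rw [geom_sum_mul, hg, sub_self]
  have hzero : s.det • (g - 1) = 0 := by
    rw [← Matrix.one_mul (g - 1), ← Matrix.smul_mul, ← adjugate_mul, Matrix.mul_assoc, hmul,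
      Matrix.mul_zero]
  exact sub_eq_zero.mp ((smul_eq_zero.mp hzero).resolve_left hdet)

/-- A torsion matrix group that is trivial modulo an ideal of residue characteristic `p` is a
`p`-group. -/
theorem Matrix.exists_pow_prime_pow_eq_one {R F : Type*} [CommRing R] [IsDomain R] [Field F]
    {n : ℕ} (f : R →+* F) {p : ℕ} [hp : Fact p.Prime] [CharP F p] (g : Matrix (Fin n) (Fin n) R)
    (hg : IsOfFinOrder g) (hfg : f.mapMatrix g = 1) : ∃ k : ℕ, g ^ p ^ k = 1 := by
  obtain ⟨k, a, ha, hka⟩ :=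
    Nat.exists_eq_pow_mul_and_not_dvd hg.orderOf_pos.ne' p hp.out.ne_one
  refine ⟨k, Matrix.eq_one_of_pow_eq_one_of_map_eq_one f _ (a := a) ?_ ?_ ?_⟩
  · rwa [ne_eq, CharP.cast_eq_zero_iff F p]
  · rw [← pow_mul, ← hka, pow_orderOf_eq_one]
  · rw [map_pow, hfg, one_pow]

/-- The kernel of a homomorphism from a group to a finite monoid has finite index. -/
theorem MonoidHom.finiteIndex_ker_of_finite {Γ H : Type*} [Group Γ] [Monoid H] [Finite H]
    (ψ : Γ →* H) : ψ.ker.FiniteIndex :=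
  Subgroup.finiteIndex_of_le (H := ψ.toHomUnits.ker) fun _ hg =>
    congrArg Units.val hg

/-- Schur's theorem over a domain that is finitely generated as a ring. -/
theorem IsMulTorsion.finite_of_injective_GL {Γ R : Type*} [Group Γ] [Group.FG Γ] [CommRing R]
    [IsDomain R] [Algebra.FiniteType ℤ R] {n : ℕ} (hΓ : IsMulTorsion Γ)
    (φ : Γ →* Matrix (Fin n) (Fin n) R) (hφ : Function.Injective φ) : Finite Γ := by
  have := Int.isJacobsonRing
  have hJR : IsJacobsonRing R := isJacobsonRing_of_finiteType (A := ℤ)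
  have hfield : ∀ m : Ideal R, m.IsMaximal → Finite (R ⧸ m) := fun m hm => by
    let := Ideal.Quotient.field m
    exact Field.finite_of_surjective_of_finiteType_int (Ideal.Quotient.mk m)
      Ideal.Quotient.mk_surjective
  have hbot : ∀ x : R, (∀ m : Ideal R, m.IsMaximal → x ∈ m) → x = 0 := fun x hx => by
    have hj : x ∈ (⊥ : Ideal R).jacobson := by
      rw [Ideal.jacobson, Submodule.mem_sInf]
      exact fun m hm => hx m hm.2
    rwa [isJacobsonRing_iff_prime_eq.mp hJR ⊥ Ideal.isPrime_bot] at hj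
  let red (m : Ideal R) : Γ →* Matrix (Fin n) (Fin n) (R ⧸ m) :=
    (Ideal.Quotient.mk m).mapMatrix.toMonoidHom.comp φ
  have hidx : ∀ m : Ideal R, m.IsMaximal → (red m).ker.FiniteIndex := fun m hm => by
    have := hfield m hm
    exact (red m).finiteIndex_ker_of_finite
  obtain ⟨m, hm⟩ := Ideal.exists_maximal R
  let := Ideal.Quotient.field m
  have := hfield m hm
  obtain ⟨p, hchar⟩ := CharP.exists (R ⧸ m)
  have hp : Fact p.Prime := ⟨CharP.char_is_prime (R ⧸ m) p⟩
  have hker : ∀ g ∈ (red m).ker, ∃ k : ℕ, φ g ^ p ^ k = 1 := fun g hg =>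
    Matrix.exists_pow_prime_pow_eq_one (Ideal.Quotient.mk m) (φ g)
      (φ.isOfFinOrder (hΓ g)) (MonoidHom.mem_ker.mp hg)
  have hpgroup : IsPGroup p (red m).ker := fun g => by
    obtain ⟨k, hk⟩ := hker g g.2
    exact ⟨k, Subtype.ext (hφ (by simpa using hk))⟩
  have hidx_m := hidx m hm
  by_cases hpR : (p : R) = 0
  · have hRchar : CharP R p := (CharP.charP_iff_prime_eq_zero hp.out).mpr hpR
    have hfin : (Set.range (φ.comp (red m).ker.subtype)).Finite := by
      rcases Nat.eq_zero_or_pos n with rfl | hn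
      · exact Set.toFinite _
      have : Nonempty (Fin n) := ⟨⟨0, hn⟩⟩
      refine Group.FG.finite_range_of_prod_sub_one_eq_zero hp.out.ne_zero _ n fun l hl => ?_
      ext i j
      refine hbot _ fun m' hm' => ?_
      let := Ideal.Quotient.field m'
      have := hfield m' hm'
      have hchar' : CharP (R ⧸ m') p :=
        (CharP.charP_iff_prime_eq_zero hp.out).mpr (by
          rw [← map_natCast (Ideal.Quotient.mk m'), hpR, map_zero])
      let ψ : Matrix (Fin n) (Fin n) R →+* Module.End (R ⧸ m') (Fin n → R ⧸ m') :=
        (Matrix.toLinAlgEquiv' : Matrix (Fin n) (Fin n) (R ⧸ m') ≃ₐ[R ⧸ m'] _).toRingHom.comp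
          (Ideal.Quotient.mk m').mapMatrix
      have h := hpgroup.prod_sub_one_eq_zero n
        (ψ.toMonoidHom.comp (φ.comp (red m).ker.subtype)) (by simp) l hl
      have h' : ψ (l.map fun g => (φ.comp (red m).ker.subtype) g - 1).prod = 0 := by
        rw [map_list_prod, List.map_map, ← h]
        congr 2
        ext1 g
        simp
      have h'' := (map_eq_zero_iff (Matrix.toLinAlgEquiv' (R := R ⧸ m') (n := Fin n))
        (AlgEquiv.injective _)).mp h'
      exact Ideal.Quotient.eq_zero_iff_mem.mp (congr_fun (congr_fun h'' i) j)
    have : Finite (red m).ker :=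
      Set.finite_range_iff (hφ.comp Subtype.val_injective) |>.mp hfin
    exact (red m).ker.finite_iff_finite_and_finiteIndex.mpr ⟨this, hidx_m⟩
  · obtain ⟨m', hm', hpm'⟩ : ∃ m' : Ideal R, m'.IsMaximal ∧ (p : R) ∉ m' := by
      by_contra! h
      exact hpR (hbot _ h)
    let := Ideal.Quotient.field m'
    have hidx_m' := hidx m' hm'
    have hinf : (red m).ker ⊓ (red m').ker = ⊥ := by
      rw [eq_bot_iff]
      rintro g ⟨hg, hg'⟩
      obtain ⟨k, hk⟩ := hker g hg
      refine hφ ((Matrix.eq_one_of_pow_eq_one_of_map_eq_one (Ideal.Quotient.mk m') (φ g) ?_ hk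
        (MonoidHom.mem_ker.mp hg')).trans (map_one φ).symm)
      rw [Nat.cast_pow]
      refine pow_ne_zero _ fun h => hpm' (Ideal.Quotient.eq_zero_iff_mem.mp ?_)
      rwa [map_natCast]
    have hindex : ((red m).ker ⊓ (red m').ker).FiniteIndex := inferInstance
    rw [hinf] at hindex
    exact (⊥ : Subgroup Γ).finite_iff_finite_and_finiteIndex.mpr ⟨inferInstance, hindex⟩

/-- A finite set of invertible matrices over a field is defined over a subring that is finitely
generated. -/
theorem Matrix.GeneralLinearGroup.exists_finiteType_subalgebra {K : Type*} [Field K] {n : ℕ}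
    (S : Set (GL (Fin n) K)) (hS : S.Finite) :
    ∃ R : Subalgebra ℤ K, Algebra.FiniteType ℤ R ∧
      S ⊆ Set.range (Matrix.GeneralLinearGroup.map (n := Fin n) (algebraMap R K)) := by
  let entries : Set K := ⋃ g ∈ S, Set.range (fun ij : Fin n × Fin n => (g : Matrix _ _ K) ij.1 ij.2)
    ∪ Set.range (fun ij : Fin n × Fin n => ((g⁻¹ : GL (Fin n) K) : Matrix _ _ K) ij.1 ij.2)
  have hfin : entries.Finite :=
    hS.biUnion fun g _ => (Set.finite_range _).union (Set.finite_range _)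
  refine ⟨Algebra.adjoin ℤ entries, (Subalgebra.fg_iff_finiteType _).mp
    ((Subalgebra.fg_def).mpr ⟨_, hfin, rfl⟩), fun g hg => ?_⟩
  have hmem : ∀ i j, (g : Matrix _ _ K) i j ∈ Algebra.adjoin ℤ entries := fun i j =>
    Algebra.subset_adjoin (Set.mem_biUnion hg (Or.inl ⟨(i, j), rfl⟩))
  have hmem' : ∀ i j, ((g⁻¹ : GL (Fin n) K) : Matrix _ _ K) i j ∈ Algebra.adjoin ℤ entries :=
    fun i j => Algebra.subset_adjoin (Set.mem_biUnion hg (Or.inr ⟨(i, j), rfl⟩))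
  let a : Matrix (Fin n) (Fin n) (Algebra.adjoin ℤ entries) := .of fun i j => ⟨_, hmem i j⟩
  let b : Matrix (Fin n) (Fin n) (Algebra.adjoin ℤ entries) := .of fun i j => ⟨_, hmem' i j⟩
  let ι := (algebraMap (Algebra.adjoin ℤ entries) K).mapMatrix (m := Fin n)
  have hι : Function.Injective ι := Matrix.map_injective Subtype.val_injective
  have ha : ι a = g := rfl
  have hb : ι b = (g⁻¹ : GL (Fin n) K) := rfl
  refine ⟨⟨a, b, hι ?_, hι ?_⟩, Units.ext ha⟩
  · rw [map_mul, ha, hb, map_one, Units.mul_inv]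
  · rw [map_mul, ha, hb, map_one, Units.inv_mul]

/-- **Theorem (Schur).** A finitely generated periodic (torsion) subgroup of `GL_n(K)`,
`K` a field, is finite. -/
theorem schur_torsion_fg_linear_group_finite
    {K : Type*} [Field K] {n : ℕ} (G : Subgroup (GL (Fin n) K))
    (hfg : G.FG) (htors : ∀ g ∈ G, IsOfFinOrder g) :
    (G : Set (GL (Fin n) K)).Finite := by
  obtain ⟨S, hSG, hS⟩ := (Subgroup.fg_iff G).mp hfg
  obtain ⟨R, hR, hSR⟩ := Matrix.GeneralLinearGroup.exists_finiteType_subalgebra S hS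
  let f : GL (Fin n) R →* GL (Fin n) K := Matrix.GeneralLinearGroup.map (algebraMap R K)
  have hf : Function.Injective f :=
    Units.map_injective (Matrix.map_injective Subtype.val_injective)
  have hGf : G ≤ f.range := by
    rw [← hSG, Subgroup.closure_le]
    exact hSR
  let e : G →* GL (Fin n) R :=
    (MonoidHom.ofInjective hf).symm.toMonoidHom.comp (Subgroup.inclusion hGf)
  have he : Function.Injective e :=
    (MonoidHom.ofInjective hf).symm.injective.comp (Subgroup.inclusion_injective hGf)
  have hGfg : Group.FG G := (Group.fg_iff_subgroup_fg G).mpr hfg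
  have htorsG : IsMulTorsion G := fun g => Submonoid.isOfFinOrder_coe.mp (htors g g.2)
  have : Finite G := htorsG.finite_of_injective_GL ((Units.coeHom _).comp e)
    (Units.val_injective.comp he)
  exact Set.toFinite _
end

section
/- Let φ : M → N be a homomorphism of monoids, let M' be a submonoid of M, and let n₁, n₂ ∈ φ(M'). Then the trace monoid tr_{φ|_{M'}}(n₁,n₂) of the restricted homomorphism φ|_{M'} : M' → φ(M') is a quotient of a submonoid of tr_φ(n₁,n₂); that is, there is a submonoid T of tr_φ(n₁,n₂) and a surjective monoid homomorphism from T onto tr_{φ|_{M'}}(n₁,n₂). In particular, if tr_φ(n₁,n₂) is locally finite then so is tr_{φ|_{M'}}(n₁,n₂). -/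
/-- If `h : A →* C` is surjective and its kernel contains that of `g : A →* B`, then `C` is a
quotient of a submonoid of `B`. -/
theorem MonoidHom.exists_submonoid_surjective_of_ker_le {A B C : Type*} [Monoid A] [Monoid B]
    [Monoid C] (g : A →* B) (h : A →* C) (hh : Function.Surjective h)
    (hker : Con.ker g ≤ Con.ker h) :
    ∃ (T : Submonoid B) (f : T →* C), Function.Surjective f :=
  ⟨MonoidHom.mrange g,
    ((Con.ker g).lift h hker).comp (Con.quotientKerEquivRange g).symm.toMonoidHom,
    (Con.lift_surjective_of_surjective hker hh).comp
      (Con.quotientKerEquivRange g).symm.surjective⟩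

/-- A submonoid of a locally finite monoid is locally finite. -/
theorem Monoid.LocallyFinite.submonoid {B : Type*} [Monoid B] (hB : Monoid.LocallyFinite B)
    (T : Submonoid B) : Monoid.LocallyFinite T := fun S hS =>
  Set.Finite.of_finite_image (f := T.subtype)
    (by simpa using hB (S.map T.subtype) (hS.map T.subtype))
    (Subtype.val_injective.injOn)

/-- A quotient of a locally finite monoid is locally finite. -/
theorem Monoid.LocallyFinite.of_surjective {B C : Type*} [Monoid B] [Monoid C]
    (hB : Monoid.LocallyFinite B) (f : B →* C) (hf : Function.Surjective f) :
    Monoid.LocallyFinite C := by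
  intro S hS
  obtain ⟨s, rfl, hs⟩ := (Submonoid.fg_iff S).1 hS
  have himage : f '' (Function.surjInv hf '' s) = s := by
    rw [← Set.image_comp, Function.RightInverse.comp_eq_id (Function.rightInverse_surjInv hf),
      Set.image_id]
  rw [← himage, ← MonoidHom.map_mclosure, Submonoid.coe_map]
  exact (hB _ ((Submonoid.fg_iff _).2 ⟨_, rfl, hs.image _⟩)).image f

/-- The inclusion of the trace submonoid of the restriction of `φ` to `M'` into that of `φ`. -/
def traceSubmonoidInclusion {M N : Type*} [Monoid M] [Monoid N] (φ : M →* N)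
    (M' : Submonoid M) (n₁ n₂ : M'.map φ) :
    traceSubmonoid (φ.submonoidMap M') n₁ n₂ →* traceSubmonoid φ n₁ n₂ :=
  (M'.subtype.comp (Submonoid.subtype _)).codRestrict _ fun m =>
    ⟨congrArg Subtype.val m.2.1, congrArg Subtype.val m.2.2⟩

/-- The congruence defining the trace of `φ` restricts to a finer congruence than the one defining
the trace of the restriction of `φ` to `M'`. -/
theorem ker_traceSubmonoidInclusion_le {M N : Type*} [Monoid M] [Monoid N] (φ : M →* N)
    (M' : Submonoid M) (n₁ n₂ : M'.map φ) :
    Con.ker ((traceCon φ n₁ n₂).mk'.comp (traceSubmonoidInclusion φ M' n₁ n₂)) ≤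
      Con.ker (traceCon (φ.submonoidMap M') n₁ n₂).mk' := by
  intro a b hab
  exact (Con.eq _).2 fun m₁ m₂ hm₁ hm₂ => Subtype.ext <|
    (Con.eq _).1 hab m₁ m₂ (congrArg Subtype.val hm₁) (congrArg Subtype.val hm₂)

/-- **Claim.** For a monoid homomorphism `φ : M →* N`, a submonoid `M' ≤ M` and
`n₁, n₂ ∈ φ(M')`, the trace monoid of the restriction `φ|_{M'} : M' →* φ(M')` at
`(n₁, n₂)` is a quotient of a submonoid of `tr_φ(n₁, n₂)`; in particular it is locally
finite whenever `tr_φ(n₁, n₂)` is. -/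
theorem traceMonoid_restriction_is_subquotient
    {M N : Type*} [Monoid M] [Monoid N] (φ : M →* N) (M' : Submonoid M)
    (n₁ n₂ : N) (h₁ : n₁ ∈ M'.map φ) (h₂ : n₂ ∈ M'.map φ) :
    (∃ (T : Submonoid (traceMonoid φ n₁ n₂))
        (f : T →* traceMonoid (φ.submonoidMap M') ⟨n₁, h₁⟩ ⟨n₂, h₂⟩),
        Function.Surjective f) ∧
      (Monoid.LocallyFinite (traceMonoid φ n₁ n₂) →
        Monoid.LocallyFinite (traceMonoid (φ.submonoidMap M') ⟨n₁, h₁⟩ ⟨n₂, h₂⟩)) := by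
  obtain ⟨T, f, hf⟩ := MonoidHom.exists_submonoid_surjective_of_ker_le
    (B := traceMonoid φ n₁ n₂)
    (C := traceMonoid (φ.submonoidMap M') ⟨n₁, h₁⟩ ⟨n₂, h₂⟩) _ _ Con.mk'_surjective
    (ker_traceSubmonoidInclusion_le φ M' ⟨n₁, h₁⟩ ⟨n₂, h₂⟩)
  exact ⟨⟨T, f, hf⟩, fun h => (h.submonoid T).of_surjective f hf⟩
end
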